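/- arXiv:1306.1315 — 2 statements merged into one kernel-verified Lean document; each statement's English description precedes it below -/
import Mathlib

section
/- In the plane, for compact convex sets K, T, A: V(K,A)·V(T,A) ≥ (1/2)·V(K,T)·V(A,A), where V denotes the two-dimensional mixed volume (so V(A,A) is the area of A and vol(A+B) = V(A,A) + 2V(A,B) + V(B,B)). -/
open MeasureTheory Pointwise

/-- The area of a subset of the plane. -/
noncomputable def area (K : Set (EuclideanSpace ℝ (Fin 2))) : ℝ := (volume K).toReal

/-- The planar mixed volume, characterized by
`area (K + T) = V(K,K) + 2 V(K,T) + V(T,T)` with `V(K,K) = area K`. -/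
noncomputable def mixedVol (K T : Set (EuclideanSpace ℝ (Fin 2))) : ℝ :=
  (area (K + T) - area K - area T) / 2

/-- The Euclidean plane. -/
abbrev Plane := EuclideanSpace ℝ (Fin 2)

/-- Nonempty compact convex subsets of the plane. -/
structure IsBody (K : Set Plane) : Prop where
  convex : Convex ℝ K
  isCompact : IsCompact K
  nonempty : K.Nonempty

namespace IsBody

variable {K T : Set Plane}

lemma add (hK : IsBody K) (hT : IsBody T) : IsBody (K + T) :=
  ⟨hK.convex.add hT.convex, hK.isCompact.add hT.isCompact, hK.nonempty.add hT.nonempty⟩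

lemma smul (s : ℝ) (hK : IsBody K) : IsBody (s • K) :=
  ⟨hK.convex.smul s, hK.isCompact.smul s, hK.nonempty.smul_set⟩

lemma singleton (x : Plane) : IsBody {x} :=
  ⟨convex_singleton x, isCompact_singleton, Set.singleton_nonempty x⟩

lemma convexHull_finite {S : Set Plane} (hS : S.Finite) (hne : S.Nonempty) :
    IsBody (convexHull ℝ S) :=
  ⟨convex_convexHull ℝ S, hS.isCompact_convexHull (𝕜 := ℝ), hne.convexHull⟩

lemma inter_le (hK : IsBody K) (f : Plane →L[ℝ] ℝ) (c : ℝ) (hne : (K ∩ {x | f x ≤ c}).Nonempty) :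
    IsBody (K ∩ {x | f x ≤ c}) :=
  ⟨hK.convex.inter (convex_halfSpace_le f.toLinearMap.isLinear c),
    hK.isCompact.inter_right (isClosed_le f.continuous continuous_const), hne⟩

lemma inter_ge (hK : IsBody K) (f : Plane →L[ℝ] ℝ) (c : ℝ) (hne : (K ∩ {x | c ≤ f x}).Nonempty) :
    IsBody (K ∩ {x | c ≤ f x}) :=
  ⟨hK.convex.inter (convex_halfSpace_ge f.toLinearMap.isLinear c),
    hK.isCompact.inter_right (isClosed_le continuous_const f.continuous), hne⟩

lemma measurableSet (hK : IsBody K) : MeasurableSet K := hK.isCompact.isClosed.measurableSet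

lemma measure_ne_top (hK : IsBody K) : volume K ≠ ⊤ := hK.isCompact.measure_lt_top.ne

end IsBody

lemma area_nonneg (K : Set Plane) : 0 ≤ area K := ENNReal.toReal_nonneg

lemma area_mono {K L : Set Plane} (hL : IsBody L) (h : K ⊆ L) : area K ≤ area L :=
  measureReal_mono h hL.measure_ne_top

lemma area_smul (s : ℝ) (K : Set Plane) : area (s • K) = s ^ 2 * area K := by
  simp [area, Measure.addHaar_smul, ENNReal.toReal_mul, sq_nonneg]

lemma area_singleton_add (x : Plane) (K : Set Plane) : area ({x} + K) = area K := by
  simp [area, Set.singleton_add]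

lemma area_singleton (x : Plane) : area {x} = 0 := by simp [area]

lemma mixedVol_comm (K T : Set Plane) : mixedVol K T = mixedVol T K := by
  simp only [mixedVol, add_comm K T]; ring

lemma mixedVol_singleton (K : Set Plane) (x : Plane) : mixedVol K {x} = 0 := by
  rw [mixedVol, add_comm K, area_singleton_add, area_singleton]; ring

lemma mixedVol_singleton_add (x : Plane) (K T : Set Plane) :
    mixedVol ({x} + K) T = mixedVol K T := by
  simp only [mixedVol, add_assoc, area_singleton_add]

lemma mixedVol_add_singleton (x : Plane) (K T : Set Plane) :
    mixedVol K ({x} + T) = mixedVol K T := by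
  rw [mixedVol_comm, mixedVol_singleton_add, mixedVol_comm]

lemma mixedVol_smul_smul (s : ℝ) (K T : Set Plane) :
    mixedVol (s • K) (s • T) = s ^ 2 * mixedVol K T := by
  simp only [mixedVol, ← smul_add, area_smul]; ring

lemma mixedVol_smul_left {s : ℝ} (hs : s ≠ 0) (K T : Set Plane) :
    mixedVol (s • K) T = s ^ 2 * mixedVol K (s⁻¹ • T) := by
  rw [← mixedVol_smul_smul, smul_inv_smul₀ hs]

lemma mixedVol_self {K : Set Plane} (hK : IsBody K) : mixedVol K K = area K := by
  have : K + K = (2 : ℝ) • K := by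
    have := hK.convex.add_smul (p := 1) (q := 1) zero_le_one zero_le_one
    rw [one_smul] at this
    rw [← this]; norm_num
  rw [mixedVol, this, area_smul]; ring

/-- The area of the Minkowski sum with a body cut by a line is a valuation. -/
lemma area_add_cut {K T : Set Plane} (hK : IsBody K) (hT : IsBody T) (f : Plane →L[ℝ] ℝ) (c : ℝ)
    (h₁ : (T ∩ {x | f x ≤ c}).Nonempty) (h₂ : (T ∩ {x | c ≤ f x}).Nonempty) :
    area (K + T) + area (K + T ∩ {x | f x = c}) =
      area (K + T ∩ {x | f x ≤ c}) + area (K + T ∩ {x | c ≤ f x}) := by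
  have hm := (hK.add (hT.inter_ge f c h₂)).measurableSet
  have key := measureReal_union_add_inter (μ := volume) (s := K + T ∩ {x | f x ≤ c}) hm
    (hK.add (hT.inter_le f c h₁)).measure_ne_top (hK.add (hT.inter_ge f c h₂)).measure_ne_top
  have hu : (K + T ∩ {x | f x ≤ c}) ∪ (K + T ∩ {x | c ≤ f x}) = K + T := by
    rw [← Set.add_union, ← Set.inter_union_distrib_left]
    congr 1
    exact Set.inter_eq_left.2 fun x _ ↦ le_total (f x) c
  have hi : (K + T ∩ {x | f x ≤ c}) ∩ (K + T ∩ {x | c ≤ f x}) = K + T ∩ {x | f x = c} := by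
    apply Set.Subset.antisymm
    · rintro z ⟨⟨k₁, hk₁, t₁, ⟨ht₁, hc₁⟩, rfl⟩, ⟨k₂, hk₂, t₂, ⟨ht₂, hc₂⟩, he⟩⟩
      simp only [Set.mem_ofPred_eq] at hc₁ hc₂ he
      obtain ⟨a, b, ha, hb, hab, habc⟩ : ∃ a b : ℝ, 0 ≤ a ∧ 0 ≤ b ∧ a + b = 1 ∧
          a * f t₁ + b * f t₂ = c := by
        have : c ∈ segment ℝ (f t₁) (f t₂) := by
          rw [segment_eq_Icc (hc₁.trans hc₂)]; exact ⟨hc₁, hc₂⟩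
        simpa [segment] using this
      refine ⟨a • k₁ + b • k₂, hK.convex hk₁ hk₂ ha hb hab, a • t₁ + b • t₂,
        ⟨hT.convex ht₁ ht₂ ha hb hab, by simpa using habc⟩, ?_⟩
      calc a • k₁ + b • k₂ + (a • t₁ + b • t₂) = a • (k₁ + t₁) + b • (k₂ + t₂) := by module
        _ = k₁ + t₁ := by rw [he, ← add_smul, hab, one_smul]
    · exact Set.subset_inter (Set.add_subset_add_left fun x hx ↦ ⟨hx.1, hx.2.le⟩)
        (Set.add_subset_add_left fun x hx ↦ ⟨hx.1, hx.2.ge⟩)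
  rw [hu, hi] at key
  exact key

lemma mixedVol_cut {K T : Set Plane} (hK : IsBody K) (hT : IsBody T) (f : Plane →L[ℝ] ℝ) (c : ℝ)
    (h₁ : (T ∩ {x | f x ≤ c}).Nonempty) (h₂ : (T ∩ {x | c ≤ f x}).Nonempty) :
    mixedVol K T + mixedVol K (T ∩ {x | f x = c}) =
      mixedVol K (T ∩ {x | f x ≤ c}) + mixedVol K (T ∩ {x | c ≤ f x}) := by
  have h := area_add_cut hK hT f c h₁ h₂
  have h0 := area_add_cut (IsBody.singleton 0) hT f c h₁ h₂
  simp only [area_singleton_add] at h0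
  simp only [mixedVol]
  linarith

/-- Monotonicity of the mixed volume: `L \ K` is split by countably many half-planes whose
intersection is `K`, and each piece is translated into `(L + T) \ (K + T)`. -/
lemma mixedVol_mono {K L T : Set Plane} (hK : IsBody K) (hL : IsBody L) (hT : IsBody T)
    (h : K ⊆ L) : mixedVol K T ≤ mixedVol L T := by
  obtain ⟨f, c, hfc⟩ := RCLike.iInter_countable_halfSpaces_eq (𝕜 := ℝ) hK.convex
    hK.isCompact.isClosed
  simp only [RCLike.re_to_real] at hfc
  have hmem : ∀ x, x ∈ K ↔ ∀ n, f n x ≤ c n := fun x ↦ by rw [← hfc]; simp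
  have hmax : ∀ n, ∃ t ∈ T, ∀ y ∈ T, f n y ≤ f n t := fun n ↦
    hT.isCompact.exists_isMaxOn hT.nonempty (f n).continuous.continuousOn
  choose t htT htmax using hmax
  let C : ℕ → Set Plane := fun n ↦ L ∩ ({x | c n < f n x} ∩ ⋂ m, ⋂ (_ : m < n), {x | f m x ≤ c m})
  have hCm : ∀ n, MeasurableSet (C n) := fun n ↦ hL.measurableSet.inter
    ((isOpen_lt continuous_const (f n).continuous).measurableSet.inter
      (MeasurableSet.iInter fun m ↦ MeasurableSet.iInter fun _ ↦
        (isClosed_le (f m).continuous continuous_const).measurableSet))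
  have hCle : ∀ {n m x}, x ∈ C n → m < n → f m x ≤ c m := by
    intro n m x hx hm
    have := hx.2.2
    simp only [Set.mem_iInter] at this
    exact this m hm
  have hdiff : L \ K ⊆ ⋃ n, C n := by
    rintro x ⟨hxL, hxK⟩
    have hex : ∃ n, c n < f n x := by
      by_contra! hcon
      exact hxK ((hmem x).2 hcon)
    classical
    refine Set.mem_iUnion.2 ⟨Nat.find hex, hxL, Nat.find_spec hex, ?_⟩
    simp only [Set.mem_iInter]
    exact fun m hm ↦ not_lt.1 (Nat.find_min hex hm)
  have hsub : ⋃ n, ({t n} + C n) ⊆ (L + T) \ (K + T) := by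
    refine Set.iUnion_subset fun n ↦ ?_
    rintro _ ⟨_, rfl, x, hx, rfl⟩
    refine ⟨⟨x, hx.1, t n, htT n, add_comm _ _⟩, ?_⟩
    rintro ⟨k, hk, y, hy, hxy⟩
    have h1 := congrArg (f n) hxy
    simp only [map_add] at h1
    have h2 : c n < f n x := hx.2.1
    linarith [(hmem k).1 hk n, htmax n y hy]
  have hdisj' : ∀ m n, m < n → Disjoint ({t m} + C m) ({t n} + C n) := by
    intro m n hmn
    rw [Set.disjoint_left]
    rintro _ ⟨_, rfl, x, hx, rfl⟩ ⟨_, rfl, y, hy, hxy⟩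
    have h1 := congrArg (f m) hxy
    simp only [map_add] at h1
    have h2 : c m < f m x := hx.2.1
    linarith [hCle hy hmn, htmax m (t n) (htT n)]
  have hdisj : Pairwise (Function.onFun Disjoint fun n ↦ {t n} + C n) := by
    intro m n hmn
    rcases lt_or_gt_of_ne hmn with h | h
    · exact hdisj' m n h
    · exact (hdisj' n m h).symm
  have hmeas : ∀ n, MeasurableSet ({t n} + C n) := fun n ↦ by
    rw [Set.singleton_add]
    exact (MeasurableEquiv.addLeft (t n)).measurableEmbedding.measurableSet_image.2 (hCm n)
  have hvol : volume (L \ K) ≤ volume ((L + T) \ (K + T)) := calc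
    volume (L \ K) ≤ ∑' n, volume (C n) := (measure_mono hdiff).trans (measure_iUnion_le _)
    _ = ∑' n, volume ({t n} + C n) := by simp [Set.singleton_add]
    _ = volume (⋃ n, ({t n} + C n)) := (measure_iUnion hdisj hmeas).symm
    _ ≤ _ := measure_mono hsub
  have hreal : volume.real (L \ K) ≤ volume.real ((L + T) \ (K + T)) :=
    ENNReal.toReal_mono (measure_ne_top_of_subset Set.sdiff_subset (hL.add hT).measure_ne_top) hvol
  rw [measureReal_sdiff h hK.measurableSet hL.measure_ne_top,
    measureReal_sdiff (Set.add_subset_add_right h) (hK.add hT).measurableSet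
      (hL.add hT).measure_ne_top] at hreal
  have : area L - area K ≤ area (L + T) - area (K + T) := hreal
  simp only [mixedVol]
  linarith

lemma mixedVol_nonneg {K T : Set Plane} (hK : IsBody K) (hT : IsBody T) : 0 ≤ mixedVol K T := by
  obtain ⟨x, hx⟩ := hK.nonempty
  have := mixedVol_mono (IsBody.singleton x) hK hT (Set.singleton_subset_iff.2 hx)
  rwa [mixedVol_comm, mixedVol_singleton] at this

/-- A basis `v, w` of the plane with its coordinate functionals. -/
structure PlaneFrame where
  v : Plane
  w : Plane
  f : Plane →L[ℝ] ℝ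
  g : Plane →L[ℝ] ℝ
  f_v : f v = 1
  f_w : f w = 0
  g_v : g v = 0
  g_w : g w = 1
  repr : ∀ x, x = f x • v + g x • w

lemma exists_planeFrame {v w : Plane} (h : LinearIndependent ℝ ![v, w]) :
    ∃ F : PlaneFrame, F.v = v ∧ F.w = w := by
  let b := basisOfLinearIndependentOfCardEqFinrank h (by simp)
  have hb : ⇑b = ![v, w] := coe_basisOfLinearIndependentOfCardEqFinrank h _
  have h0 : b 0 = v := by simp [hb]
  have h1 : b 1 = w := by simp [hb]
  refine ⟨⟨v, w, (b.coord 0).toContinuousLinearMap, (b.coord 1).toContinuousLinearMap,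
    ?_, ?_, ?_, ?_, fun x ↦ ?_⟩, rfl, rfl⟩
  · simp [← h0]
  · simp [← h1]
  · simp [← h0]
  · simp [← h1]
  · have := b.sum_repr x
    rw [Fin.sum_univ_two, h0, h1] at this
    exact this.symm

lemma mem_singleton_add_iff {p x : Plane} {S : Set Plane} : x ∈ {p} + S ↔ x - p ∈ S := by
  rw [Set.singleton_add]
  constructor
  · rintro ⟨y, hy, rfl⟩
    simpa using hy
  · exact fun h ↦ ⟨x - p, h, by simp⟩

lemma smul_singleton_add (s : ℝ) (p : Plane) (S : Set Plane) :
    s • ({p} + S) = {s • p} + s • S := by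
  rw [smul_add, Set.smul_set_singleton]

namespace PlaneFrame

variable (F : PlaneFrame)

/-- The parallelogram spanned by `a • v` and `b • w`. -/
def box (a b : ℝ) : Set Plane := {x | 0 ≤ F.f x ∧ F.f x ≤ a ∧ 0 ≤ F.g x ∧ F.g x ≤ b}

/-- The triangle with vertices `0`, `s • v`, `s • w`. -/
def tri (s : ℝ) : Set Plane := {x | 0 ≤ F.f x ∧ 0 ≤ F.g x ∧ F.f x + F.g x ≤ s}

lemma f_comb (a b : ℝ) : F.f (a • F.v + b • F.w) = a := by simp [F.f_v, F.f_w]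

lemma g_comb (a b : ℝ) : F.g (a • F.v + b • F.w) = b := by simp [F.g_v, F.g_w]

lemma isBody_box {a b : ℝ} (ha : 0 ≤ a) (hb : 0 ≤ b) : IsBody (F.box a b) := by
  refine ⟨?_, ?_, ⟨0, by simp [box, ha, hb]⟩⟩
  · intro x hx y hy c d hc hd hcd
    obtain ⟨h1, h2, h3, h4⟩ := hx
    obtain ⟨k1, k2, k3, k4⟩ := hy
    simp only [box, Set.mem_ofPred_eq, map_add, map_smul, smul_eq_mul]
    obtain rfl : d = 1 - c := by linarith
    refine ⟨by positivity, by nlinarith, by positivity, by nlinarith⟩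
  · have : F.box a b = (fun p : ℝ × ℝ ↦ p.1 • F.v + p.2 • F.w) '' (Set.Icc 0 a ×ˢ Set.Icc 0 b) := by
      ext x
      constructor
      · rintro ⟨h1, h2, h3, h4⟩
        exact ⟨(F.f x, F.g x), ⟨⟨h1, h2⟩, ⟨h3, h4⟩⟩, (F.repr x).symm⟩
      · rintro ⟨p, ⟨⟨h1, h2⟩, ⟨h3, h4⟩⟩, rfl⟩
        simp only [box, Set.mem_ofPred_eq, f_comb, g_comb]
        exact ⟨h1, h2, h3, h4⟩
    rw [this]
    exact (isCompact_Icc.prod isCompact_Icc).image (by fun_prop)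

lemma isBody_tri {s : ℝ} (hs : 0 ≤ s) : IsBody (F.tri s) := by
  refine ⟨?_, ?_, ⟨0, by simp [tri, hs]⟩⟩
  · intro x hx y hy c d hc hd hcd
    obtain ⟨h1, h2, h3⟩ := hx
    obtain ⟨k1, k2, k3⟩ := hy
    simp only [tri, Set.mem_ofPred_eq, map_add, map_smul, smul_eq_mul]
    obtain rfl : d = 1 - c := by linarith
    refine ⟨by positivity, by positivity, by nlinarith⟩
  · refine (F.isBody_box hs hs).isCompact.of_isClosed_subset ?_ ?_
    · exact (isClosed_le continuous_const F.f.continuous).inter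
        ((isClosed_le continuous_const F.g.continuous).inter
          (isClosed_le (F.f.continuous.add F.g.continuous) continuous_const))
    · rintro x ⟨h1, h2, h3⟩
      exact ⟨h1, by linarith, h2, by linarith⟩

lemma smul_box {s : ℝ} (hs : 0 < s) (a b : ℝ) : s • F.box a b = F.box (s * a) (s * b) := by
  ext x
  rw [Set.mem_smul_set_iff_inv_smul_mem₀ hs.ne']
  simp only [box, Set.mem_ofPred_eq, map_smul, smul_eq_mul, inv_mul_le_iff₀ hs,
    mul_nonneg_iff_of_pos_left (inv_pos.2 hs)]

lemma smul_tri {s : ℝ} (hs : 0 < s) (a : ℝ) : s • F.tri a = F.tri (s * a) := by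
  ext x
  rw [Set.mem_smul_set_iff_inv_smul_mem₀ hs.ne']
  simp only [tri, Set.mem_ofPred_eq, map_smul, smul_eq_mul, ← mul_add, inv_mul_le_iff₀ hs,
    mul_nonneg_iff_of_pos_left (inv_pos.2 hs)]

lemma box_zero_zero : F.box 0 0 = {0} := by
  ext x
  simp only [box, Set.mem_ofPred_eq, Set.mem_singleton_iff]
  constructor
  · rintro ⟨h1, h2, h3, h4⟩
    rw [F.repr x, le_antisymm h2 h1, le_antisymm h4 h3]; simp
  · rintro rfl; simp

variable {A : Set Plane}

lemma mixedVol_box_add_left (hA : IsBody A) {a a' b : ℝ} (ha : 0 ≤ a) (ha' : 0 ≤ a') (hb : 0 ≤ b) :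
    mixedVol A (F.box (a + a') b) + mixedVol A (F.box 0 b) =
      mixedVol A (F.box a b) + mixedVol A (F.box a' b) := by
  have h1 : F.box (a + a') b ∩ {x | F.f x ≤ a} = F.box a b := by
    ext x; simp only [box, Set.mem_inter_iff, Set.mem_ofPred_eq]; grind
  have h2 : F.box (a + a') b ∩ {x | a ≤ F.f x} = {a • F.v} + F.box a' b := by
    ext x
    simp only [mem_singleton_add_iff, box, Set.mem_inter_iff, Set.mem_ofPred_eq, map_sub, map_smul,
      smul_eq_mul, F.f_v, F.g_v]
    grind
  have h3 : F.box (a + a') b ∩ {x | F.f x = a} = {a • F.v} + F.box 0 b := by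
    ext x
    simp only [mem_singleton_add_iff, box, Set.mem_inter_iff, Set.mem_ofPred_eq, map_sub, map_smul,
      smul_eq_mul, F.f_v, F.g_v]
    grind
  have := mixedVol_cut hA (F.isBody_box (add_nonneg ha ha') hb) F.f a
    (by rw [h1]; exact (F.isBody_box ha hb).nonempty)
    (by rw [h2]; exact ((IsBody.singleton _).add (F.isBody_box ha' hb)).nonempty)
  rwa [h1, h2, h3, mixedVol_add_singleton, mixedVol_add_singleton] at this

lemma mixedVol_box_add_right (hA : IsBody A) {a b b' : ℝ} (ha : 0 ≤ a) (hb : 0 ≤ b) (hb' : 0 ≤ b') :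
    mixedVol A (F.box a (b + b')) + mixedVol A (F.box a 0) =
      mixedVol A (F.box a b) + mixedVol A (F.box a b') := by
  have h1 : F.box a (b + b') ∩ {x | F.g x ≤ b} = F.box a b := by
    ext x; simp only [box, Set.mem_inter_iff, Set.mem_ofPred_eq]; grind
  have h2 : F.box a (b + b') ∩ {x | b ≤ F.g x} = {b • F.w} + F.box a b' := by
    ext x
    simp only [mem_singleton_add_iff, box, Set.mem_inter_iff, Set.mem_ofPred_eq, map_sub, map_smul,
      smul_eq_mul, F.f_w, F.g_w]
    grind
  have h3 : F.box a (b + b') ∩ {x | F.g x = b} = {b • F.w} + F.box a 0 := by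
    ext x
    simp only [mem_singleton_add_iff, box, Set.mem_inter_iff, Set.mem_ofPred_eq, map_sub, map_smul,
      smul_eq_mul, F.f_w, F.g_w]
    grind
  have := mixedVol_cut hA (F.isBody_box ha (add_nonneg hb hb')) F.g b
    (by rw [h1]; exact (F.isBody_box ha hb).nonempty)
    (by rw [h2]; exact ((IsBody.singleton _).add (F.isBody_box ha hb')).nonempty)
  rwa [h1, h2, h3, mixedVol_add_singleton, mixedVol_add_singleton] at this

/-- The defect of additivity of the mixed volume on a parallelogram. -/
noncomputable def boxDefect (A : Set Plane) (a b : ℝ) : ℝ :=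
  mixedVol A (F.box a b) - mixedVol A (F.box a 0) - mixedVol A (F.box 0 b)

lemma boxDefect_half (hA : IsBody A) {a b : ℝ} (ha : 0 ≤ a) (hb : 0 ≤ b) :
    F.boxDefect ((2 : ℝ)⁻¹ • A) a b = F.boxDefect A a b := by
  have h2 : (0 : ℝ) < 2⁻¹ := by norm_num
  have key : ∀ c d, mixedVol ((2 : ℝ)⁻¹ • A) (F.box c d) =
      4⁻¹ * mixedVol A (F.box (c + c) (d + d)) := by
    intro c d
    rw [mixedVol_smul_left h2.ne', inv_inv, F.smul_box two_pos, two_mul, two_mul]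
    norm_num
  simp only [boxDefect, key, add_zero]
  have e0 := F.mixedVol_box_add_right hA ha le_rfl le_rfl
  have e1 := F.mixedVol_box_add_left hA ha ha hb
  have e2 := F.mixedVol_box_add_left hA ha ha le_rfl
  have e3 := F.mixedVol_box_add_right hA (add_nonneg ha ha) hb hb
  have e4 := F.mixedVol_box_add_right hA le_rfl hb hb
  rw [box_zero_zero, mixedVol_singleton] at e2 e4
  linarith

lemma exists_subset_box (hA : IsBody A) : ∃ (p : Plane) (R : ℝ), 0 < R ∧ A ⊆ {p} + F.box R R := by
  obtain ⟨r, hr⟩ := (hA.isCompact.image F.f.continuous).isBounded.exists_norm_le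
  obtain ⟨r', hr'⟩ := (hA.isCompact.image F.g.continuous).isBounded.exists_norm_le
  let R := max (max r r') 1
  have hR1 : 1 ≤ R := le_max_right _ _
  have hrR : r ≤ R := (le_max_left _ _).trans (le_max_left _ _)
  have hrR' : r' ≤ R := (le_max_right _ _).trans (le_max_left _ _)
  refine ⟨(-R) • F.v + (-R) • F.w, 2 * R, by linarith, fun x hx ↦ ?_⟩
  have h1 := abs_le.1 ((hr _ ⟨x, hx, rfl⟩).trans hrR)
  have h2 := abs_le.1 ((hr' _ ⟨x, hx, rfl⟩).trans hrR')
  rw [mem_singleton_add_iff]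
  simp only [box, Set.mem_ofPred_eq, map_sub, f_comb, g_comb]
  refine ⟨?_, ?_, ?_, ?_⟩ <;> linarith

lemma mixedVol_box_box {s t : ℝ} (hs : 0 < s) (ht : 0 < t) :
    mixedVol (F.box s s) (F.box t t) = s * t * area (F.box 1 1) := by
  have h : ∀ {r : ℝ}, 0 < r → F.box r r = r • F.box 1 1 := fun hr ↦ by
    rw [F.smul_box hr, mul_one]
  have hc := (F.isBody_box zero_le_one zero_le_one).convex
  rw [h hs, h ht, mixedVol, ← hc.add_smul hs.le ht.le]
  simp only [area_smul]
  ring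

lemma box_mono {a b a' b' : ℝ} (ha : a ≤ a') (hb : b ≤ b') : F.box a b ⊆ F.box a' b' :=
  fun _ ⟨h1, h2, h3, h4⟩ ↦ ⟨h1, h2.trans ha, h3, h4.trans hb⟩

lemma boxDefect_eq_zero (hA : IsBody A) {a b : ℝ} (ha : 0 ≤ a) (hb : 0 ≤ b) :
    F.boxDefect A a b = 0 := by
  have hpow : ∀ n : ℕ, F.boxDefect (((2 : ℝ)⁻¹ ^ n) • A) a b = F.boxDefect A a b := by
    intro n
    induction n with
    | zero => simp
    | succ n ih => rw [pow_succ', mul_smul, F.boxDefect_half (hA.smul _) ha hb, ih]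
  obtain ⟨p, R, hR, hsub⟩ := F.exists_subset_box hA
  let c := a + b + 1
  have hc : 0 < c := by positivity
  have hbound : ∀ n : ℕ, |F.boxDefect A a b| ≤ (2 : ℝ)⁻¹ ^ n * (2 * (R * c * area (F.box 1 1))) := by
    intro n
    have hn : (0 : ℝ) < 2⁻¹ ^ n := by positivity
    rw [← hpow n]
    have hAn := hA.smul ((2 : ℝ)⁻¹ ^ n)
    have hle : mixedVol ((2 : ℝ)⁻¹ ^ n • A) (F.box a b) ≤
        (2 : ℝ)⁻¹ ^ n * R * c * area (F.box 1 1) := by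
      have s1 : (2 : ℝ)⁻¹ ^ n • A ⊆ {(2 : ℝ)⁻¹ ^ n • p} + F.box ((2 : ℝ)⁻¹ ^ n * R) ((2 : ℝ)⁻¹ ^ n * R) := by
        rw [← F.smul_box hn, ← smul_singleton_add]
        exact Set.smul_set_mono hsub
      have hb1 := F.isBody_box (a := (2 : ℝ)⁻¹ ^ n * R) (b := (2 : ℝ)⁻¹ ^ n * R)
        (by positivity) (by positivity)
      have m1 := mixedVol_mono hAn ((IsBody.singleton _).add hb1) (F.isBody_box ha hb) s1
      rw [mixedVol_singleton_add] at m1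
      have m2 := mixedVol_mono (F.isBody_box ha hb) (F.isBody_box hc.le hc.le) hb1
        (F.box_mono (by simp only [c]; linarith) (by simp only [c]; linarith))
      rw [mixedVol_comm (F.box a b), F.mixedVol_box_box hc (by positivity)] at m2
      linarith
    have l1 : mixedVol ((2 : ℝ)⁻¹ ^ n • A) (F.box a 0) ≤ mixedVol ((2 : ℝ)⁻¹ ^ n • A) (F.box a b) := by
      rw [mixedVol_comm, mixedVol_comm _ (F.box a b)]
      exact mixedVol_mono (F.isBody_box ha le_rfl) (F.isBody_box ha hb) hAn (F.box_mono le_rfl hb)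
    have l2 : mixedVol ((2 : ℝ)⁻¹ ^ n • A) (F.box 0 b) ≤ mixedVol ((2 : ℝ)⁻¹ ^ n • A) (F.box a b) := by
      rw [mixedVol_comm, mixedVol_comm _ (F.box a b)]
      exact mixedVol_mono (F.isBody_box le_rfl hb) (F.isBody_box ha hb) hAn (F.box_mono ha le_rfl)
    have l3 := mixedVol_nonneg hAn (F.isBody_box ha (le_refl 0))
    have l4 := mixedVol_nonneg hAn (F.isBody_box (le_refl 0) hb)
    have l5 := mixedVol_nonneg hAn (F.isBody_box ha hb)
    rw [boxDefect, abs_le]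
    constructor <;> linarith
  have hlim : Filter.Tendsto (fun n : ℕ ↦ (2 : ℝ)⁻¹ ^ n * (2 * (R * c * area (F.box 1 1))))
      Filter.atTop (nhds 0) := by
    simpa using (tendsto_pow_atTop_nhds_zero_of_lt_one (r := (2 : ℝ)⁻¹) (by norm_num)
      (by norm_num)).mul_const (2 * (R * c * area (F.box 1 1)))
  exact abs_nonpos_iff.1 (ge_of_tendsto' hlim hbound)

lemma mixedVol_tri_add (hA : IsBody A) {s t : ℝ} (hs : 0 ≤ s) (ht : 0 ≤ t) :
    mixedVol A (F.tri (s + t)) = mixedVol A (F.tri s) + mixedVol A (F.tri t) := by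
  set Q := F.tri (s + t) ∩ {x | F.f x ≤ t} with hQ
  have a2 : F.tri (s + t) ∩ {x | t ≤ F.f x} = {t • F.v} + F.tri s := by
    ext x
    simp only [mem_singleton_add_iff, tri, Set.mem_inter_iff, Set.mem_ofPred_eq, map_sub, map_smul,
      smul_eq_mul, F.f_v, F.g_v]
    grind
  have a3 : F.tri (s + t) ∩ {x | F.f x = t} = {t • F.v} + F.box 0 s := by
    ext x
    simp only [mem_singleton_add_iff, box, tri, Set.mem_inter_iff, Set.mem_ofPred_eq, map_sub,
      map_smul, smul_eq_mul, F.f_v, F.g_v]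
    grind
  have b1 : Q ∩ {x | F.g x ≤ s} = F.box t s := by
    ext x; simp only [hQ, box, tri, Set.mem_inter_iff, Set.mem_ofPred_eq]; grind
  have b2 : Q ∩ {x | s ≤ F.g x} = {s • F.w} + F.tri t := by
    ext x
    simp only [hQ, mem_singleton_add_iff, tri, Set.mem_inter_iff, Set.mem_ofPred_eq, map_sub,
      map_smul, smul_eq_mul, F.f_w, F.g_w]
    grind
  have b3 : Q ∩ {x | F.g x = s} = {s • F.w} + F.box t 0 := by
    ext x
    simp only [hQ, mem_singleton_add_iff, box, tri, Set.mem_inter_iff, Set.mem_ofPred_eq, map_sub,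
      map_smul, smul_eq_mul, F.f_w, F.g_w]
    grind
  have hT := F.isBody_tri (add_nonneg hs ht)
  have hQne : Q.Nonempty := by
    have := (F.isBody_box ht hs).nonempty
    rw [← b1] at this
    exact this.mono Set.inter_subset_left
  have e1 := mixedVol_cut hA hT F.f t hQne
    (by rw [a2]; exact ((IsBody.singleton _).add (F.isBody_tri hs)).nonempty)
  have e2 := mixedVol_cut hA (hT.inter_le F.f t hQne) F.g s
    (by rw [← hQ, b1]; exact (F.isBody_box ht hs).nonempty)
    (by rw [← hQ, b2]; exact ((IsBody.singleton _).add (F.isBody_tri ht)).nonempty)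
  rw [← hQ, a2, a3, mixedVol_add_singleton, mixedVol_add_singleton] at e1
  rw [← hQ, b1, b2, b3, mixedVol_add_singleton, mixedVol_add_singleton] at e2
  have e3 := F.boxDefect_eq_zero hA ht hs
  rw [boxDefect] at e3
  linarith

end PlaneFrame

lemma eq_mul_of_additive_of_nonneg {φ : ℝ → ℝ} (hadd : ∀ s t, 0 ≤ s → 0 ≤ t → φ (s + t) = φ s + φ t)
    (hnn : ∀ s, 0 ≤ s → 0 ≤ φ s) {s : ℝ} (hs : 0 ≤ s) : φ s = s * φ 1 := by
  have h0 : φ 0 = 0 := by have := hadd 0 0 le_rfl le_rfl; simp at this; exact this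
  have hmul : ∀ (n : ℕ) (t : ℝ), 0 ≤ t → φ (n * t) = n * φ t := by
    intro n t ht
    induction n with
    | zero => simp [h0]
    | succ n ih =>
      push_cast
      rw [add_mul, one_mul, hadd _ _ (by positivity) ht, ih]; ring
  have hmono : ∀ {a b : ℝ}, 0 ≤ a → a ≤ b → φ a ≤ φ b := by
    intro a b ha hab
    have := hadd a (b - a) ha (by linarith)
    rw [add_sub_cancel] at this
    linarith [hnn (b - a) (by linarith)]
  have hnat : ∀ n : ℕ, φ n = n * φ 1 := fun n ↦ by simpa using hmul n 1 zero_le_one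
  have hkey : ∀ n : ℕ, n * |φ s - s * φ 1| ≤ φ 1 := by
    intro n
    have hns : 0 ≤ (n : ℝ) * s := by positivity
    have l1 := hmono (Nat.cast_nonneg _) (Nat.floor_le hns)
    have l2 := hmono hns (Nat.lt_floor_add_one ((n : ℝ) * s)).le
    have l3 : φ (⌊(n : ℝ) * s⌋₊ + 1) = (⌊(n : ℝ) * s⌋₊ + 1) * φ 1 := by exact_mod_cast hnat _
    rw [hnat, hmul n s hs] at l1
    rw [l3, hmul n s hs] at l2
    have h1 := hnn 1 zero_le_one
    have l4 := mul_le_mul_of_nonneg_right (Nat.floor_le hns) h1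
    have l5 := mul_le_mul_of_nonneg_right (Nat.lt_floor_add_one ((n : ℝ) * s)).le h1
    rw [← Nat.abs_cast n, ← abs_mul, abs_le]
    constructor <;> nlinarith
  by_contra hne
  have hpos : 0 < |φ s - s * φ 1| := abs_pos.2 (sub_ne_zero.2 hne)
  obtain ⟨n, hn⟩ := exists_nat_gt (φ 1 / |φ s - s * φ 1|)
  rw [div_lt_iff₀ hpos] at hn
  linarith [hkey n]

/-- `T` is *homogeneous* if the mixed volume with `T` is homogeneous in the other argument. -/
def IsHomogeneous (T : Set Plane) : Prop :=
  ∀ A, IsBody A → ∀ s : ℝ, 0 < s → mixedVol (s • A) T = s * mixedVol A T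

lemma IsHomogeneous.singleton (x : Plane) : IsHomogeneous {x} := fun A _ s _ ↦ by
  simp [mixedVol_singleton]

lemma IsHomogeneous.singleton_add {T : Set Plane} (h : IsHomogeneous T) (x : Plane) :
    IsHomogeneous ({x} + T) := fun A hA s hs ↦ by
  simp only [mixedVol_add_singleton, h A hA s hs]

lemma IsHomogeneous.of_cut {T : Set Plane} (hT : IsBody T) (f : Plane →L[ℝ] ℝ) (c : ℝ)
    (h₁ : (T ∩ {x | f x ≤ c}).Nonempty) (h₂ : (T ∩ {x | c ≤ f x}).Nonempty)
    (hle : IsHomogeneous (T ∩ {x | f x ≤ c})) (hge : IsHomogeneous (T ∩ {x | c ≤ f x}))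
    (heq : IsHomogeneous (T ∩ {x | f x = c})) : IsHomogeneous T := fun A hA s hs ↦ by
  have e1 := mixedVol_cut hA hT f c h₁ h₂
  have e2 := mixedVol_cut (hA.smul s) hT f c h₁ h₂
  rw [hle A hA s hs, hge A hA s hs, heq A hA s hs] at e2
  linear_combination e2 - s * e1

lemma PlaneFrame.isHomogeneous_tri (F : PlaneFrame) : IsHomogeneous (F.tri 1) := fun A hA s hs ↦ by
  rw [mixedVol_smul_left hs.ne', F.smul_tri (inv_pos.2 hs), mul_one,
    eq_mul_of_additive_of_nonneg (φ := fun t ↦ mixedVol A (F.tri t))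
      (fun _ _ h h' ↦ F.mixedVol_tri_add hA h h')
      (fun _ h ↦ mixedVol_nonneg hA (F.isBody_tri h)) (inv_pos.2 hs).le]
  field_simp

lemma PlaneFrame.isHomogeneous_box_zero (F : PlaneFrame) : IsHomogeneous (F.box 1 0) :=
    fun A hA s hs ↦ by
  rw [mixedVol_smul_left hs.ne', F.smul_box (inv_pos.2 hs), mul_one, mul_zero,
    eq_mul_of_additive_of_nonneg (φ := fun t ↦ mixedVol A (F.box t 0))
      (fun _ _ h h' ↦ ?_)
      (fun _ h ↦ mixedVol_nonneg hA (F.isBody_box h le_rfl)) (inv_pos.2 hs).le]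
  · field_simp
  · have := F.mixedVol_box_add_left hA h h' (le_refl 0)
    rwa [F.box_zero_zero, mixedVol_singleton, add_zero] at this

lemma add_smul_mem_convexHull_triple {a b c : Plane} {α β γ : ℝ} (hα : 0 ≤ α) (hβ : 0 ≤ β)
    (hγ : 0 ≤ γ) (h : α + β + γ = 1) :
    α • a + β • b + γ • c ∈ convexHull ℝ {a, b, c} := by
  have hmem : ∀ i, (![a, b, c] : Fin 3 → Plane) i ∈ convexHull ℝ ({a, b, c} : Set Plane) := by
    intro i
    apply subset_convexHull
    fin_cases i <;> simp
  have := (convex_convexHull ℝ ({a, b, c} : Set Plane)).sum_mem (t := Finset.univ)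
    (w := ![α, β, γ]) (z := ![a, b, c])
    (by intro i _; fin_cases i <;> assumption) (by simpa [Fin.sum_univ_three] using h)
    (fun i _ ↦ hmem i)
  simpa [Fin.sum_univ_three] using this

lemma PlaneFrame.convexHull_triple (F : PlaneFrame) (a : Plane) :
    convexHull ℝ {a, a + F.v, a + F.w} = {a} + F.tri 1 := by
  apply Set.Subset.antisymm
  · apply convexHull_min
    · rintro x (rfl | rfl | rfl) <;>
        simp [tri, F.f_v, F.f_w, F.g_v, F.g_w]
    · exact ((IsBody.singleton a).add (F.isBody_tri zero_le_one)).convex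
  · intro x hx
    rw [mem_singleton_add_iff] at hx
    obtain ⟨h1, h2, h3⟩ := hx
    have hx : x = (1 - F.f (x - a) - F.g (x - a)) • a + F.f (x - a) • (a + F.v) +
        F.g (x - a) • (a + F.w) := by
      have := F.repr (x - a)
      rw [sub_eq_iff_eq_add] at this
      nth_rewrite 1 [this]
      module
    rw [hx]
    exact add_smul_mem_convexHull_triple (by linarith) h1 h2 (by ring)

lemma PlaneFrame.segment_eq (F : PlaneFrame) (a : Plane) :
    segment ℝ a (a + F.v) = {a} + F.box 1 0 := by
  ext x
  rw [mem_singleton_add_iff, segment_eq_image', Set.mem_image]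
  constructor
  · rintro ⟨t, ⟨h0, h1⟩, rfl⟩
    simp [box, F.f_v, F.g_v, h0, h1]
  · rintro ⟨h1, h2, h3, h4⟩
    refine ⟨F.f (x - a), ⟨h1, h2⟩, ?_⟩
    have := F.repr (x - a)
    rw [le_antisymm h4 h3, zero_smul, add_zero] at this
    rw [add_sub_cancel_left, ← this]
    abel

lemma isHomogeneous_segment {a b : Plane} (hab : a ≠ b) : IsHomogeneous (segment ℝ a b) := by
  obtain ⟨w, hw⟩ := exists_linearIndependent_pair_of_one_lt_finrank (R := ℝ) (M := Plane)
    (by simp) (sub_ne_zero.2 hab.symm)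
  obtain ⟨F, hv, -⟩ := exists_planeFrame hw
  have := F.segment_eq a
  rw [hv, add_sub_cancel] at this
  rw [this]
  exact F.isHomogeneous_box_zero.singleton_add a

/-- A point of a convex hull on a line through two of the vertices does not lie beyond an
extremal vertex. -/
lemma le_one_of_mem_convexHull {S : Set Plane} {b c x : Plane} {t : ℝ} (hb : b ∈ S) (hc : c ∈ S)
    (hbc : b ≠ c) (hext : c ∉ convexHull ℝ (S \ {c})) (hx : x ∈ convexHull ℝ S)
    (hxt : x = b + t • (c - b)) : t ≤ 1 := by
  by_contra! ht
  have hb' : b ∈ convexHull ℝ (S \ {c}) := subset_convexHull _ _ ⟨hb, hbc⟩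
  rw [← Set.insert_sdiff_self_of_mem hc, convexHull_insert (Set.nonempty_of_mem (Set.mem_sdiff_singleton.2 ⟨hb, hbc⟩)),
    convexJoin_singleton_left] at hx
  simp only [Set.mem_iUnion] at hx
  obtain ⟨y, hy, α, β, hα, hβ, hαβ, rfl⟩ := hx
  have hpos : 0 < t - α := by linarith
  have : c = ((t - 1) / (t - α)) • b + (β / (t - α)) • y := by
    have e : (t - α) • c = (t - 1) • b + β • y := by
      linear_combination (norm := module) (-1 : ℝ) • hxt
    rw [div_eq_inv_mul, div_eq_inv_mul, mul_smul, mul_smul, ← smul_add, ← e,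
      inv_smul_smul₀ hpos.ne']
  have hmem := convex_convexHull ℝ _ hb' hy (a := (t - 1) / (t - α)) (b := β / (t - α))
    (by apply div_nonneg <;> linarith) (by positivity) (by field_simp; linarith)
  rw [← this] at hmem
  exact hext hmem

lemma mem_segment_of_mem_convexHull {S : Set Plane} {b c x : Plane} {t : ℝ} (hb : b ∈ S)
    (hc : c ∈ S) (hbc : b ≠ c) (hextb : b ∉ convexHull ℝ (S \ {b}))
    (hextc : c ∉ convexHull ℝ (S \ {c})) (hx : x ∈ convexHull ℝ S)
    (hxt : x = b + t • (c - b)) : x ∈ segment ℝ b c := by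
  have h1 := le_one_of_mem_convexHull hb hc hbc hextc hx hxt
  have h0 := le_one_of_mem_convexHull (t := 1 - t) hc hb hbc.symm hextb hx (by rw [hxt]; module)
  rw [segment_eq_image']
  exact ⟨t, ⟨by linarith, h1⟩, hxt.symm⟩

lemma convexHull_inter_le {S : Set Plane} (f : Plane →L[ℝ] ℝ) (c : ℝ)
    (hne : (S ∩ {x | f x = c}).Nonempty)
    (h : convexHull ℝ S ∩ {x | f x = c} ⊆ convexHull ℝ (S ∩ {x | f x = c})) :
    convexHull ℝ S ∩ {x | f x ≤ c} = convexHull ℝ (S ∩ {x | f x ≤ c}) := by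
  have hsub : convexHull ℝ (S ∩ {x | f x = c}) ⊆ convexHull ℝ (S ∩ {x | f x ≤ c}) :=
    convexHull_mono fun x hx ↦ ⟨hx.1, le_of_eq hx.2⟩
  apply Set.Subset.antisymm
  · rintro x ⟨hx, hxc⟩
    rw [Set.mem_ofPred_eq] at hxc
    obtain ⟨q, hqS, hqc : f q = c⟩ := hne
    have hS : S = (S ∩ {x | f x ≤ c}) ∪ (S ∩ {x | c ≤ f x}) := by
      ext z
      simp only [Set.mem_union, Set.mem_inter_iff, Set.mem_ofPred_eq]
      have := le_total (f z) c
      tauto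
    have hx' := hx
    rw [hS, convexHull_union (s := S ∩ {x | f x ≤ c}) (t := S ∩ {x | c ≤ f x}) ⟨q, hqS, hqc.le⟩ ⟨q, hqS, hqc.ge⟩, mem_convexJoin] at hx'
    obtain ⟨y, hy, z, hz, hxyz⟩ := hx'
    rw [segment_eq_image'] at hxyz
    obtain ⟨u, ⟨hu0, hu1⟩, rfl⟩ := hxyz
    have hyc : f y ≤ c := convexHull_min Set.inter_subset_right (convex_halfSpace_le f.isLinear c) hy
    have hzc : c ≤ f z := convexHull_min Set.inter_subset_right (convex_halfSpace_ge f.isLinear c) hz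
    rcases hzc.eq_or_lt with hzc | hzc
    · have hz' : z ∈ convexHull ℝ (S ∩ {x | f x ≤ c}) :=
        hsub (h ⟨convexHull_mono Set.inter_subset_left hz, hzc.symm⟩)
      exact (convex_convexHull ℝ _).add_smul_sub_mem hy hz' ⟨hu0, hu1⟩
    · have hd : 0 < f z - f y := by linarith
      set r := (c - f y) / (f z - f y) with hr
      have hr0 : 0 ≤ r := div_nonneg (by linarith) hd.le
      have hr1 : r ≤ 1 := by rw [hr, div_le_one hd]; linarith
      have hrm : r * (f z - f y) = c - f y := by rw [hr]; field_simp
      simp only [map_add, map_smul, map_sub, smul_eq_mul] at hxc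
      have hur : u ≤ r := by rw [hr, le_div_iff₀ hd]; linarith
      have hm : y + r • (z - y) ∈ convexHull ℝ (S ∩ {x | f x ≤ c}) := by
        apply hsub
        apply h
        refine ⟨(convex_convexHull ℝ _).add_smul_sub_mem
          (convexHull_mono Set.inter_subset_left hy)
          (convexHull_mono Set.inter_subset_left hz) ⟨hr0, hr1⟩, ?_⟩
        simp only [Set.mem_ofPred_eq, map_add, map_smul, map_sub, smul_eq_mul]
        linarith
      rcases hr0.eq_or_lt with h0 | h0
      · have : u = 0 := by linarith
        simpa [this] using hy
      · have e : y + u • (z - y) = y + (u / r) • (y + r • (z - y) - y) := by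
          rw [add_sub_cancel_left, smul_smul, div_mul_cancel₀ _ h0.ne']
        change y + u • (z - y) ∈ _
        rw [e]
        exact (convex_convexHull ℝ _).add_smul_sub_mem hy hm
          ⟨by positivity, (div_le_one h0).2 hur⟩
  · exact Set.subset_inter (convexHull_mono Set.inter_subset_left)
      (convexHull_min Set.inter_subset_right (convex_halfSpace_le f.isLinear c))

lemma convexHull_inter_ge {S : Set Plane} (f : Plane →L[ℝ] ℝ) (c : ℝ)
    (hne : (S ∩ {x | f x = c}).Nonempty)
    (h : convexHull ℝ S ∩ {x | f x = c} ⊆ convexHull ℝ (S ∩ {x | f x = c})) :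
    convexHull ℝ S ∩ {x | c ≤ f x} = convexHull ℝ (S ∩ {x | c ≤ f x}) := by
  have := convexHull_inter_le (S := S) (-f) (-c) (by simpa using hne) (by simpa using h)
  simpa using this

/-- If a diagonal `b c` of a polygon strictly separates the vertices `a` and `d`, homogeneity can be
checked on the two parts. -/
lemma IsHomogeneous.of_diagonal {S : Finset Plane} {a b c d : Plane} {γ δ : ℝ} (ha : a ∈ S)
    (hb : b ∈ S) (hc : c ∈ S) (hd : d ∈ S) (hbc : b ≠ c)
    (hli : LinearIndependent ℝ ![c - b, a - b])
    (hextb : b ∉ convexHull ℝ ((S : Set Plane) \ {b}))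
    (hextc : c ∉ convexHull ℝ ((S : Set Plane) \ {c}))
    (hdδ : d - b = γ • (c - b) + δ • (a - b)) (hδ : δ < 0)
    (ih : ∀ S' ⊂ S, S'.Nonempty → IsHomogeneous (convexHull ℝ (S' : Set Plane))) :
    IsHomogeneous (convexHull ℝ (S : Set Plane)) := by
  obtain ⟨F, hv, hw⟩ := exists_planeFrame hli
  have gb : F.g c = F.g b := by
    have := F.g_v
    rw [hv, map_sub] at this; linarith
  have ga : F.g a = F.g b + 1 := by
    have := F.g_w
    rw [hw, map_sub] at this; linarith
  have gd : F.g d = F.g b + δ := by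
    have := congrArg F.g hdδ
    simp only [map_sub, map_add, map_smul, smul_eq_mul, gb, ga] at this
    linarith
  have hline : convexHull ℝ (S : Set Plane) ∩ {x | F.g x = F.g b} = segment ℝ b c := by
    apply Set.Subset.antisymm
    · rintro x ⟨hx, hxg⟩
      rw [Set.mem_ofPred_eq] at hxg
      refine mem_segment_of_mem_convexHull (t := F.f (x - b)) hb hc hbc hextb hextc hx ?_
      have := F.repr (x - b)
      rw [map_sub F.g, hxg, sub_self, zero_smul, add_zero, hv] at this
      rw [← this]; abel
    · apply Set.subset_inter (segment_subset_convexHull hb hc)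
      rw [← convexHull_pair]
      apply convexHull_min _ (convex_hyperplane F.g.isLinear _)
      rintro x (rfl | rfl)
      exacts [rfl, gb]
  have hsub : convexHull ℝ (S : Set Plane) ∩ {x | F.g x = F.g b} ⊆
      convexHull ℝ ((S : Set Plane) ∩ {x | F.g x = F.g b}) := by
    rw [hline]
    exact segment_subset_convexHull ⟨hb, rfl⟩ ⟨hc, gb⟩
  have hne : ((S : Set Plane) ∩ {x | F.g x = F.g b}).Nonempty := ⟨b, hb, rfl⟩
  have hbS := subset_convexHull ℝ (S : Set Plane) hb
  refine IsHomogeneous.of_cut (.convexHull_finite S.finite_toSet ⟨b, hb⟩) F.g (F.g b)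
    ⟨b, hbS, le_refl (F.g b)⟩ ⟨b, hbS, le_refl (F.g b)⟩ ?_ ?_ ?_
  · rw [convexHull_inter_le _ _ hne hsub]
    have := ih (S.filter fun x ↦ F.g x ≤ F.g b) (Finset.filter_ssubset.2 ⟨a, ha, by linarith⟩)
      ⟨b, by simp [hb]⟩
    rwa [Finset.coe_filter] at this
  · rw [convexHull_inter_ge _ _ hne hsub]
    have := ih (S.filter fun x ↦ F.g b ≤ F.g x) (Finset.filter_ssubset.2 ⟨d, hd, by linarith⟩)
      ⟨b, by simp [hb]⟩
    rwa [Finset.coe_filter] at this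
  · rw [hline]
    exact isHomogeneous_segment hbc

lemma isHomogeneous_convexHull_finset (S : Finset Plane) (hS : S.Nonempty) :
    IsHomogeneous (convexHull ℝ (S : Set Plane)) := by
  classical
  induction S using Finset.strongInduction with
  | H S ih =>
  by_cases hext : ∃ x ∈ S, x ∈ convexHull ℝ ((S : Set Plane) \ {x})
  · obtain ⟨x, hx, hxc⟩ := hext
    have e : convexHull ℝ (S : Set Plane) = convexHull ℝ (S.erase x : Set Plane) := by
      apply Set.Subset.antisymm
      · apply convexHull_min _ (convex_convexHull _ _)
        intro y hy
        by_cases hyx : y = x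
        · rw [hyx, Finset.coe_erase]; exact hxc
        · exact subset_convexHull _ _ (by simpa [hyx] using hy)
      · exact convexHull_mono (by simp)
    rw [e]
    apply ih _ (Finset.erase_ssubset hx)
    have : ((S : Set Plane) \ {x}).Nonempty := convexHull_nonempty_iff.1 ⟨x, hxc⟩
    rwa [← Finset.coe_erase, Finset.coe_nonempty] at this
  push Not at hext
  obtain ⟨a, ha⟩ := hS
  by_cases h1 : S = {a}
  · rw [h1]; simpa using IsHomogeneous.singleton a
  obtain ⟨b, hb, hba⟩ : ∃ b ∈ S, b ≠ a := by
    by_contra! h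
    exact h1 (Finset.eq_singleton_iff_unique_mem.2 ⟨ha, h⟩)
  by_cases h2 : S = {a, b}
  · rw [h2, Finset.coe_pair, convexHull_pair]
    exact isHomogeneous_segment hba.symm
  obtain ⟨c, hc, hca, hcb⟩ : ∃ c ∈ S, c ≠ a ∧ c ≠ b := by
    by_contra! h
    apply h2
    ext x
    simp only [Finset.mem_insert, Finset.mem_singleton]
    refine ⟨fun hx ↦ or_iff_not_imp_left.2 (h x hx), ?_⟩
    rintro (rfl | rfl) <;> assumption
  have hli : ∀ x ∈ S, ∀ y ∈ S, ∀ z ∈ S, y ≠ x → z ≠ x → z ≠ y →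
      LinearIndependent ℝ ![y - x, z - x] := by
    intro x hx y hy z hz hyx hzx hzy
    rw [LinearIndependent.pair_iff' (sub_ne_zero.2 hyx)]
    intro t ht
    have hzS := mem_segment_of_mem_convexHull (t := t) hx hy hyx.symm (hext x hx) (hext y hy)
      (subset_convexHull ℝ _ hz) (by rw [ht]; abel)
    refine hext z hz ?_
    exact segment_subset_convexHull (s := (S : Set Plane) \ {z}) ⟨hx, hzx.symm⟩ ⟨hy, hzy.symm⟩ hzS
  obtain ⟨F, hv, hw⟩ := exists_planeFrame (hli a ha b hb c hc hba hca hcb)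
  by_cases h3 : S = {a, b, c}
  · have := F.convexHull_triple a
    rw [hv, hw, add_sub_cancel, add_sub_cancel] at this
    rw [h3, Finset.coe_insert, Finset.coe_pair, this]
    exact F.isHomogeneous_tri.singleton_add a
  obtain ⟨d, hd, hda, hdb, hdc⟩ : ∃ d ∈ S, d ≠ a ∧ d ≠ b ∧ d ≠ c := by
    by_contra! h
    apply h3
    ext x
    simp only [Finset.mem_insert, Finset.mem_singleton]
    refine ⟨fun hx ↦ ?_, ?_⟩
    · have := h x hx
      tauto
    · rintro (rfl | rfl | rfl) <;> assumption
  have hrep := F.repr (d - a)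
  rw [hv, hw] at hrep
  set β := F.f (d - a)
  set γ := F.g (d - a)
  by_cases hβ : β < 0
  · exact .of_diagonal hb ha hc hd hca.symm (hli a ha c hc b hb hca hba hcb.symm) (hext a ha)
      (hext c hc) (γ := γ) (hrep.trans (add_comm _ _)) hβ ih
  by_cases hγ : γ < 0
  · exact .of_diagonal hc ha hb hd hba.symm (hli a ha b hb c hc hba hca hcb) (hext a ha)
      (hext b hb) hrep hγ ih
  by_cases hα : 1 - β - γ < 0
  · refine .of_diagonal ha hb hc hd hcb.symm (hli b hb c hc a ha hcb hba.symm hca.symm)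
      (hext b hb) (hext c hc) (γ := γ) (δ := 1 - β - γ) ?_ hα ih
    linear_combination (norm := module) (1 : ℝ) • hrep
  · exfalso
    push Not at hα hβ hγ
    refine hext d hd (convexHull_mono (s := {a, b, c}) ?_ ?_)
    · rintro x (rfl | rfl | rfl)
      exacts [⟨ha, hda.symm⟩, ⟨hb, hdb.symm⟩, ⟨hc, hdc.symm⟩]
    · have : d = (1 - β - γ) • a + β • b + γ • c := by
        linear_combination (norm := module) (1 : ℝ) • hrep
      rw [this]
      exact add_smul_mem_convexHull_triple hα hβ hγ (by ring)

lemma tendsto_area_of_monotone {C : ℕ → Set Plane} {D : Set Plane} (hmono : Monotone C)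
    (hC : ∀ n, Convex ℝ (C n)) (hsub : ∀ n, C n ⊆ D) (hD : IsBody D)
    (hcl : D ⊆ closure (⋃ n, C n)) :
    Filter.Tendsto (fun n ↦ area (C n)) Filter.atTop (nhds (area D)) := by
  have hconv : Convex ℝ (⋃ n, C n) := (hmono.directed_le).convex_iUnion hC
  have heq : volume D = volume (⋃ n, C n) := by
    apply le_antisymm
    · calc volume D ≤ volume (closure (⋃ n, C n)) := measure_mono hcl
        _ ≤ volume ((⋃ n, C n) ∪ frontier (⋃ n, C n)) := by
          rw [← closure_eq_self_union_frontier]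
        _ ≤ _ := (measure_union_le _ _).trans (by rw [hconv.addHaar_frontier volume, add_zero])
    · exact measure_mono (Set.iUnion_subset hsub)
  rw [area, heq]
  exact (ENNReal.tendsto_toReal (heq ▸ hD.measure_ne_top)).comp
    (tendsto_measure_iUnion_atTop hmono)

lemma IsBody.exists_seq_finset {T : Set Plane} (hT : IsBody T) : ∃ S : ℕ → Finset Plane,
    (∀ n, (S n).Nonempty) ∧ Monotone (fun n ↦ convexHull ℝ (S n : Set Plane)) ∧
    (∀ n, convexHull ℝ (S n : Set Plane) ⊆ T) ∧
    T ⊆ closure (⋃ n, convexHull ℝ (S n : Set Plane)) := by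
  classical
  have := hT.nonempty.to_subtype
  let u := TopologicalSpace.denseSeq T
  let S : ℕ → Finset Plane := fun n ↦ (Finset.range (n + 1)).image fun i ↦ (u i : Plane)
  refine ⟨S, fun n ↦ by simp [S], ?_, ?_, ?_⟩
  · intro m n hmn
    refine convexHull_mono (Finset.coe_subset.2 (Finset.image_subset_image ?_))
    exact Finset.range_subset_range.2 (by omega)
  · intro n
    apply convexHull_min _ hT.convex
    intro x hx
    simp only [S, Finset.coe_image, Set.mem_image] at hx
    obtain ⟨i, -, rfl⟩ := hx
    exact (u i).2
  · intro x hx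
    have h1 : (⟨x, hx⟩ : T) ∈ closure (Set.range u) := TopologicalSpace.denseRange_denseSeq T _
    have h2 := image_closure_subset_closure_image continuous_subtype_val
      (Set.mem_image_of_mem Subtype.val h1)
    refine closure_mono ?_ h2
    rintro _ ⟨_, ⟨i, rfl⟩, rfl⟩
    refine Set.mem_iUnion.2 ⟨i, subset_convexHull _ _ ?_⟩
    simp only [S, Finset.coe_image]
    exact ⟨i, by simp, rfl⟩

lemma IsBody.isHomogeneous {T : Set Plane} (hT : IsBody T) : IsHomogeneous T := by
  obtain ⟨S, hne, hmono, hsub, hcl⟩ := hT.exists_seq_finset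
  have hlim : ∀ {A : Set Plane}, IsBody A → Filter.Tendsto
      (fun n ↦ mixedVol A (convexHull ℝ (S n : Set Plane))) Filter.atTop
      (nhds (mixedVol A T)) := by
    intro A hA
    have h1 := tendsto_area_of_monotone hmono (fun n ↦ convex_convexHull ℝ _) hsub hT hcl
    have h2 := tendsto_area_of_monotone (C := fun n ↦ A + convexHull ℝ (S n : Set Plane))
      (D := A + T) (fun m n h ↦ Set.add_subset_add_left (hmono h))
      (fun n ↦ hA.convex.add (convex_convexHull ℝ _)) (fun n ↦ Set.add_subset_add_left (hsub n))
      (hA.add hT) ?_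
    · exact ((h2.sub_const (area A)).sub h1).div_const 2
    · rintro _ ⟨a, ha, t, ht, rfl⟩
      have := image_closure_subset_closure_image (continuous_const_add a)
        (Set.mem_image_of_mem (a + ·) (hcl ht))
      refine closure_mono ?_ this
      rintro _ ⟨y, hy, rfl⟩
      obtain ⟨n, hn⟩ := Set.mem_iUnion.1 hy
      exact Set.mem_iUnion.2 ⟨n, Set.add_mem_add ha hn⟩
  intro A hA s hs
  refine tendsto_nhds_unique (hlim (hA.smul s)) (((hlim hA).const_mul s).congr fun n ↦ ?_)
  exact (isHomogeneous_convexHull_finset (S n) (hne n) A hA s hs).symm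

lemma volume_interior_of_convex {C : Set Plane} (hC : Convex ℝ C) :
    volume (interior C) = volume C := by
  apply le_antisymm (measure_mono interior_subset)
  calc volume C ≤ volume (interior C ∪ frontier C) := by
        rw [← closure_eq_interior_union_frontier]; exact measure_mono subset_closure
    _ ≤ _ := (measure_union_le _ _).trans (by rw [hC.addHaar_frontier volume, add_zero])

lemma area_interior {C : Set Plane} (hC : Convex ℝ C) : area (interior C) = area C := by
  rw [area, volume_interior_of_convex hC, area]

lemma volume_segment (P Q : Plane) : volume (segment ℝ P Q) = 0 := by
  refine measure_mono_null (t := (affineSpan ℝ {P, Q} : Set Plane)) ?_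
    (Measure.addHaar_affineSubspace volume _ ?_)
  · rw [← convexHull_pair]
    exact convexHull_subset_affineSpan _
  · intro h
    have h1 := collinear_pair ℝ P Q
    rw [collinear_iff_finrank_le_one, ← direction_affineSpan, h, AffineSubspace.direction_top,
      finrank_top] at h1
    simp at h1

lemma lt_of_mem_interior {B : Set Plane} {G : Plane →L[ℝ] ℝ} (hG : G ≠ 0) {c : ℝ}
    (h : ∀ b ∈ B, G b ≤ c) {x : Plane} (hx : x ∈ interior B) : G x < c := by
  have ho : IsOpen (G '' interior B) := G.isOpenMap_of_ne_zero hG _ isOpen_interior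
  have hs : G '' interior B ⊆ Set.Iic c := by
    rintro _ ⟨b, hb, rfl⟩
    exact h b (interior_subset hb)
  have := interior_maximal hs ho (Set.mem_image_of_mem G hx)
  rwa [interior_Iic] at this

lemma area_union_translates {C : Set Plane} (hC : Convex ℝ C) (hfin : volume C ≠ ⊤) {P Q : Plane}
    (hdisj : ∀ z, z ∈ interior C → z + (Q - P) ∉ interior C) :
    area ({P} + interior C ∪ ({Q} + interior C)) = 2 * area C := by
  have hfin' : ∀ x : Plane, volume ({x} + interior C) ≠ ⊤ := fun x ↦ by
    simpa [Set.singleton_add, volume_interior_of_convex hC] using hfin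
  have hd : Disjoint ({P} + interior C) ({Q} + interior C) := by
    rw [Set.disjoint_left]
    intro x hx hx'
    rw [mem_singleton_add_iff] at hx hx'
    apply hdisj _ hx'
    rwa [show x - Q + (Q - P) = x - P by abel]
  have h := measureReal_union hd (isOpen_interior.add_left).measurableSet (hfin' P) (hfin' Q)
  change area _ = area _ + area _ at h
  rw [h, area_singleton_add, area_singleton_add, area_interior hC, two_mul]

/-- If two points of `S` do not fit simultaneously in the interior of a translate of `B`, then
`V(S, B)` is at least half the area of `B`. -/
lemma area_le_of_pair {S B : Set Plane} (hS : IsBody S) (hB : IsBody B) {P Q : Plane} (hP : P ∈ S)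
    (hQ : Q ∈ S) (hdisj : ∀ z, z ∈ interior B → z + (Q - P) ∉ interior B) :
    area B ≤ 2 * mixedVol S B := by
  have hseg : IsBody (segment ℝ P Q) := by
    rw [← convexHull_pair]
    exact .convexHull_finite (by simp) (by simp)
  have h1 := mixedVol_mono hseg hS hB (hS.convex.segment_subset hP hQ)
  have h2 := area_union_translates hB.convex hB.measure_ne_top hdisj
  have h3 : area ({P} + interior B ∪ ({Q} + interior B)) ≤ area (segment ℝ P Q + B) := by
    refine area_mono (hseg.add hB) (Set.union_subset ?_ ?_)
    · exact Set.add_subset_add (by simpa using left_mem_segment ℝ P Q) interior_subset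
    · exact Set.add_subset_add (by simpa using right_mem_segment ℝ P Q) interior_subset
  have h4 : area (segment ℝ P Q) = 0 := by rw [area, volume_segment, ENNReal.toReal_zero]
  rw [mixedVol] at h1
  linarith

/-- Cutting off a cap of `L` beyond the edge `P Q` of `S` does not increase
`2 * mixedVol S L - area L`, provided the two translates of the cap by `P` and `Q` do not
overlap. -/
lemma two_mul_mixedVol_sub_area_cut_le {S L : Set Plane} (hS : IsBody S) (hL : IsBody L)
    {P Q : Plane} (hP : P ∈ S) (hQ : Q ∈ S) {h : Plane →L[ℝ] ℝ} {c : ℝ}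
    (hSc : ∀ x ∈ S, h x ≤ c) (hPc : h P = c) (hQc : h Q = c)
    (hne : (L ∩ {x | h x ≤ c}).Nonempty)
    (hdisj : ∀ z, c < h z → z ∈ interior L → z + (Q - P) ∉ interior L) :
    2 * mixedVol S (L ∩ {x | h x ≤ c}) - area (L ∩ {x | h x ≤ c}) ≤
      2 * mixedVol S L - area L := by
  set L' := L ∩ {x | h x ≤ c} with hL'
  have hL'b : IsBody L' := hL.inter_le h c hne
  set C := L ∩ {x | c < h x} with hC
  have hCc : Convex ℝ C := hL.convex.inter (convex_halfSpace_gt h.isLinear c)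
  have hCL : C ⊆ L := Set.inter_subset_left
  have hCfin : volume C ≠ ⊤ := measure_ne_top_of_subset hCL hL.measure_ne_top
  have hcz : ∀ z ∈ interior C, c < h z := fun z hz ↦ (interior_subset hz).2
  have h1 := area_union_translates hCc hCfin (P := P) (Q := Q) fun z hz hz' ↦
    hdisj z (hcz z hz) (interior_mono hCL hz) (interior_mono hCL hz')
  have hCm : MeasurableSet C :=
    hL.measurableSet.inter (isOpen_lt continuous_const h.continuous).measurableSet
  have h2 : area L = area L' + area C := by
    have hu : L = L' ∪ C := by
      rw [hL', hC, ← Set.inter_union_distrib_left, eq_comm, Set.inter_eq_left]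
      exact fun x _ ↦ le_or_gt (h x) c
    have hd : Disjoint L' C := Set.disjoint_left.2 fun x hx hx' ↦ (lt_irrefl c) (hx'.2.trans_le hx.2)
    have := measureReal_union hd hCm hL'b.measure_ne_top hCfin
    rwa [← hu] at this
  have h3 : area (S + L') + 2 * area C ≤ area (S + L) := by
    set U := {P} + interior C ∪ ({Q} + interior C) with hU
    have hUsub : U ⊆ S + L := Set.union_subset
      (Set.add_subset_add (by simpa) (interior_subset.trans hCL))
      (Set.add_subset_add (by simpa) (interior_subset.trans hCL))
    have hUm : MeasurableSet U :=
      ((isOpen_interior.add_left).union isOpen_interior.add_left).measurableSet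
    have hd : Disjoint (S + L') U := by
      rw [Set.disjoint_left]
      rintro _ ⟨s, hs, l, hl, rfl⟩ hx
      have hsl : h (s + l) ≤ c + c := by
        rw [map_add]; exact add_le_add (hSc s hs) hl.2
      rcases hx with hx | hx <;>
      · rw [mem_singleton_add_iff] at hx
        have := hcz _ hx
        rw [map_sub] at this
        linarith
    have := measureReal_union hd hUm (hS.add hL'b).measure_ne_top
      (measure_ne_top_of_subset hUsub (hS.add hL).measure_ne_top)
    change area _ = area _ + area _ at this
    rw [← h1, ← this]
    exact area_mono (hS.add hL) (Set.union_subset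
      (Set.add_subset_add_left Set.inter_subset_left) hUsub)
  simp only [mixedVol]
  linarith

lemma notMem_interior_of_cap {B : Set Plane} {P Q R : Plane} (hP : P ∈ B) (hQ : Q ∈ B)
    (hR : R ∈ B) {F G H : Plane →L[ℝ] ℝ} (hsum : F + G + H = 0) (hF0 : F ≠ 0) (hG0 : G ≠ 0)
    (hF : ∀ b ∈ B, F b ≤ F P) (hG : ∀ b ∈ B, G b ≤ G Q) (hH : ∀ b ∈ B, H b ≤ H R)
    {z : Plane} {α β : ℝ} (hz : z - P = α • (Q - P) + β • (R - P)) (hβ : β < 0)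
    (hzB : z ∈ interior B) : z + (Q - P) ∉ interior B := by
  intro hzB'
  have e : ∀ x, F x + G x + H x = 0 := fun x ↦ by
    simpa using congrArg (fun φ : Plane →L[ℝ] ℝ ↦ φ x) hsum
  have f1 := lt_of_mem_interior hF0 hF hzB
  have g1 := lt_of_mem_interior hG0 hG hzB'
  have f2 := hF Q hQ
  have f3 := hF R hR
  have g2 := hG P hP
  have g3 := hG R hR
  have h2 := hH P hP
  have h3 := hH Q hQ
  have ev := e (Q - P)
  have ew := e (R - P)
  have fz := congrArg F hz
  have gz := congrArg G hz
  simp only [map_add, map_sub, map_smul, smul_eq_mul] at *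
  have eF : ∃ x, x = F P - F Q := ⟨_, rfl⟩
  have eF' : ∃ x, x = F P - F R := ⟨_, rfl⟩
  have eG : ∃ x, x = G Q - G P := ⟨_, rfl⟩
  have eG' : ∃ x, x = G R - G P := ⟨_, rfl⟩
  obtain ⟨a, ha⟩ := eF
  obtain ⟨a', ha'⟩ := eF'
  obtain ⟨b, hb⟩ := eG
  obtain ⟨b', hb'⟩ := eG'
  have i1 : 0 ≤ a := by linarith
  have i2 : 0 ≤ a' := by linarith
  have i3 : 0 ≤ b := by linarith
  have i4 : b' ≤ b := by linarith
  have i5 : b' ≤ a' := by linarith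
  have i6 : a - b ≤ a' - b' := by linarith
  have k1 : -β * a' < α * a := by rw [ha, ha']; linarith
  have k2 : α * b < -β * b' := by rw [hb, hb']; linarith
  obtain ⟨μ, hμ⟩ : ∃ μ, μ = -β := ⟨_, rfl⟩
  have hμ0 : 0 < μ := by linarith
  rw [← hμ] at k1 k2
  have hα : 0 < α := by
    by_contra! hα
    nlinarith [mul_nonneg hμ0.le i2]
  have hb0 : 0 < b' := by
    by_contra! hb0
    nlinarith [mul_nonneg hα.le i3]
  have hαμ : α < μ := by
    by_contra! hαμ
    nlinarith
  have j1 : μ * (a' - b') < α * (a - b) := by linarith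
  nlinarith

lemma area_le_of_strip {S B : Set Plane} (hS : IsBody S) (hB : IsBody B) {P Q : Plane} (hP : P ∈ S)
    (hQ : Q ∈ S) {G H : Plane →L[ℝ] ℝ} (hG : G ≠ 0) (hGH : G + H = 0) (hGP : ∀ b ∈ B, G b ≤ G P)
    (hHQ : ∀ b ∈ B, H b ≤ H Q) : area B ≤ 2 * mixedVol S B := by
  refine area_le_of_pair hS hB hP hQ fun z hz hz' ↦ ?_
  obtain rfl : H = -G := (neg_eq_of_add_eq_zero_right hGH).symm
  have h1 := lt_of_mem_interior hG hGP hz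
  have h2 := lt_of_mem_interior (neg_ne_zero.2 hG) hHQ hz'
  simp only [neg_apply, map_add, map_sub] at h2
  linarith

/-- If `P, Q, R ∈ B` are in a critical position, i.e. have outer normals summing to zero, then the
area of `B` is at most twice its mixed volume with the triangle `P Q R`. -/
lemma area_le_of_normals {B : Set Plane} (hB : IsBody B) {P Q R : Plane}
    (hli : LinearIndependent ℝ ![Q - P, R - P]) (hP : P ∈ B) (hQ : Q ∈ B) (hR : R ∈ B)
    {F G H : Plane →L[ℝ] ℝ} (hsum : F + G + H = 0) (hne : ¬ (F = 0 ∧ G = 0 ∧ H = 0))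
    (hF : ∀ b ∈ B, F b ≤ F P) (hG : ∀ b ∈ B, G b ≤ G Q) (hH : ∀ b ∈ B, H b ≤ H R) :
    area B ≤ 2 * mixedVol (convexHull ℝ {P, Q, R}) B := by
  have hS : IsBody (convexHull ℝ {P, Q, R}) := .convexHull_finite (by simp) (by simp)
  have hPS : P ∈ convexHull ℝ {P, Q, R} := subset_convexHull _ _ (by simp)
  have hQS : Q ∈ convexHull ℝ {P, Q, R} := subset_convexHull _ _ (by simp)
  have hRS : R ∈ convexHull ℝ {P, Q, R} := subset_convexHull _ _ (by simp)
  by_cases hF0 : F = 0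
  · refine area_le_of_strip hS hB hQS hRS (fun hG0 ↦ hne ⟨hF0, hG0, ?_⟩) ?_ hG hH
    · simpa [hF0, hG0] using hsum
    · simpa [hF0] using hsum
  by_cases hG0 : G = 0
  · exact area_le_of_strip hS hB hPS hRS hF0 (by simpa [hG0] using hsum) hF hH
  by_cases hH0 : H = 0
  · exact area_le_of_strip hS hB hPS hQS hF0 (by simpa [hH0] using hsum) hF hG
  obtain ⟨Φ, hv, hw⟩ := exists_planeFrame hli
  have hSe : convexHull ℝ {P, Q, R} = {P} + Φ.tri 1 := by
    have := Φ.convexHull_triple P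
    rwa [hv, hw, add_sub_cancel, add_sub_cancel] at this
  set S := convexHull ℝ {P, Q, R}
  have hSB : S ⊆ B := convexHull_min (by rintro x (rfl | rfl | rfl) <;> assumption) hB.convex
  have hmem : ∀ x, x ∈ S ↔ 0 ≤ Φ.f x - Φ.f P ∧ 0 ≤ Φ.g x - Φ.g P ∧
      Φ.f x - Φ.f P + (Φ.g x - Φ.g P) ≤ 1 := fun x ↦ by
    rw [hSe, mem_singleton_add_iff, PlaneFrame.tri, Set.mem_ofPred_eq, map_sub, map_sub]
  have fQ : Φ.f Q = Φ.f P + 1 := by have := Φ.f_v; rw [hv, map_sub] at this; linarith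
  have gQ : Φ.g Q = Φ.g P := by have := Φ.g_v; rw [hv, map_sub] at this; linarith
  have fR : Φ.f R = Φ.f P := by have := Φ.f_w; rw [hw, map_sub] at this; linarith
  have gR : Φ.g R = Φ.g P + 1 := by have := Φ.g_w; rw [hw, map_sub] at this; linarith
  have hrep : ∀ z, z - P = (Φ.f z - Φ.f P) • (Q - P) + (Φ.g z - Φ.g P) • (R - P) := fun z ↦ by
    have := Φ.repr (z - P)
    rwa [hv, hw, map_sub, map_sub] at this
  let h₁ := -Φ.g
  let h₂ := -Φ.f
  let h₃ := Φ.f + Φ.g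
  let L₁ := B ∩ {x | h₁ x ≤ h₁ P}
  let L₂ := L₁ ∩ {x | h₂ x ≤ h₂ P}
  let L₃ := L₂ ∩ {x | h₃ x ≤ h₃ Q}
  have n₁ : (B ∩ {x | h₁ x ≤ h₁ P}).Nonempty := ⟨P, hP, le_refl (h₁ P)⟩
  have b₁ : IsBody L₁ := hB.inter_le h₁ _ n₁
  have n₂ : (L₁ ∩ {x | h₂ x ≤ h₂ P}).Nonempty := ⟨P, ⟨hP, le_refl (h₁ P)⟩, le_refl (h₂ P)⟩
  have b₂ : IsBody L₂ := b₁.inter_le h₂ _ n₂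
  have hPL : h₃ P ≤ h₃ Q := by simp [h₃, fQ, gQ]
  have n₃ : (L₂ ∩ {x | h₃ x ≤ h₃ Q}).Nonempty :=
    ⟨P, ⟨⟨hP, le_refl (h₁ P)⟩, le_refl (h₂ P)⟩, hPL⟩
  have hsub₁ : interior L₁ ⊆ interior B := interior_mono Set.inter_subset_left
  have hsub₂ : interior L₂ ⊆ interior B := (interior_mono Set.inter_subset_left).trans hsub₁
  have e₁ := two_mul_mixedVol_sub_area_cut_le hS hB hPS hQS (h := h₁)
    (fun x hx ↦ by have := (hmem x).1 hx; simp only [h₁, neg_apply]; linarith)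
    rfl (by simp [h₁, gQ]) n₁ fun z hz hzB ↦ by
      simp only [h₁, neg_apply] at hz
      exact notMem_interior_of_cap hP hQ hR hsum hF0 hG0 hF hG hH (hrep z) (by linarith) hzB
  have e₂ := two_mul_mixedVol_sub_area_cut_le hS b₁ hPS hRS (h := h₂)
    (fun x hx ↦ by have := (hmem x).1 hx; simp only [h₂, neg_apply]; linarith)
    rfl (by simp [h₂, fR]) n₂ fun z hz hzB hzB' ↦ by
      simp only [h₂, neg_apply] at hz
      exact notMem_interior_of_cap hP hR hQ (by rw [← hsum]; abel) hF0 hH0 hF hH hG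
        ((hrep z).trans (add_comm _ _)) (by linarith) (hsub₁ hzB) (hsub₁ hzB')
  have e₃ := two_mul_mixedVol_sub_area_cut_le hS b₂ hQS hRS (h := h₃)
    (fun x hx ↦ by
      have := (hmem x).1 hx
      simp only [h₃, add_apply, fQ, gQ]; linarith)
    rfl (by simp only [h₃, add_apply, fQ, gQ, fR, gR]; ring) n₃
    fun z hz hzB hzB' ↦ by
      simp only [h₃, add_apply, fQ, gQ] at hz
      refine notMem_interior_of_cap hQ hR hP (by rw [← hsum]; abel) hG0 hH0 hG hH hF
        (α := Φ.g z - Φ.g P) (β := 1 - (Φ.f z - Φ.f P) - (Φ.g z - Φ.g P)) ?_ (by linarith)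
        (hsub₂ hzB) (hsub₂ hzB')
      linear_combination (norm := module) (1 : ℝ) • hrep z
  have hL : L₂ ∩ {x | h₃ x ≤ h₃ Q} = S := by
    ext x
    simp only [L₂, L₁, h₁, h₂, h₃, Set.mem_inter_iff, Set.mem_ofPred_eq, hmem,
      neg_apply, add_apply, fQ, gQ]
    constructor
    · rintro ⟨⟨⟨-, h1⟩, h2⟩, h3⟩
      exact ⟨by linarith, by linarith, by linarith⟩
    · rintro ⟨h1, h2, h3⟩
      exact ⟨⟨⟨hSB ((hmem x).2 ⟨h1, h2, h3⟩), by linarith⟩, by linarith⟩, by linarith⟩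
  rw [hL, mixedVol_self hS] at e₃
  have := area_nonneg S
  change _ ≤ 2 * mixedVol S L₁ - area L₁ at e₂
  change 2 * mixedVol S L₁ - area L₁ ≤ _ at e₁
  change 2 * mixedVol S L₂ - area L₂ ≤ _ at e₂
  linarith

lemma exists_normals {B : Set Plane} (hB : IsBody B) (hBint : (interior B).Nonempty)
    {P : Fin 3 → Plane} (hP : ∀ i, P i ∈ B) (hfit : ∀ z, ∃ i, P i + z ∉ interior B) :
    ∃ F : Fin 3 → Plane →L[ℝ] ℝ, F 0 + F 1 + F 2 = 0 ∧ ¬ (F 0 = 0 ∧ F 1 = 0 ∧ F 2 = 0) ∧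
      ∀ i, ∀ b ∈ B, F i b ≤ F i (P i) := by
  let U : Set (Fin 3 → Plane) := {x | ∀ i, P i + x i ∈ interior B}
  let D : Set (Fin 3 → Plane) := Set.range fun z : Plane ↦ fun _ ↦ z
  have hUo : IsOpen U := by
    simp only [U, Set.ofPred_forall]
    exact isOpen_iInter_of_finite fun i ↦
      isOpen_interior.preimage (continuous_const.add (continuous_apply i))
  have hUc : Convex ℝ U := by
    intro x hx y hy a b ha hb hab i
    have := hB.convex.interior (hx i) (hy i) ha hb hab
    have e : P i + (a • x + b • y) i = a • (P i + x i) + b • (P i + y i) := by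
      simp only [Pi.add_apply, Pi.smul_apply]
      nth_rewrite 1 [← one_smul ℝ (P i), ← hab]
      module
    rwa [e]
  have hDc : Convex ℝ D := by
    rintro _ ⟨x, rfl⟩ _ ⟨y, rfl⟩ a b - - -
    exact ⟨a • x + b • y, rfl⟩
  have hd : Disjoint U D := by
    rw [Set.disjoint_left]
    rintro _ hx ⟨z, rfl⟩
    obtain ⟨i, hi⟩ := hfit z
    exact hi (hx i)
  obtain ⟨f, u, hfU, hfD⟩ := geometric_hahn_banach_open hUc hUo hDc hd
  have hu : u ≤ 0 := by simpa using hfD 0 ⟨0, rfl⟩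
  let F : Fin 3 → Plane →L[ℝ] ℝ := fun i ↦ f.comp (ContinuousLinearMap.single ℝ (fun _ ↦ Plane) i)
  have hFf : ∀ x, f x = F 0 (x 0) + F 1 (x 1) + F 2 (x 2) := by
    intro x
    have : x = Pi.single 0 (x 0) + Pi.single 1 (x 1) + Pi.single 2 (x 2) := by
      ext i : 1
      fin_cases i <;> simp
    nth_rewrite 1 [this]
    simp [F]
  have hdiag : ∀ z, F 0 z + F 1 z + F 2 z = 0 := by
    intro z
    by_contra hz
    set r := F 0 z + F 1 z + F 2 z with hr
    have := hfD (fun _ ↦ ((u - 1) / r) • z) ⟨_, rfl⟩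
    rw [hFf] at this
    simp only [map_smul, smul_eq_mul, ← mul_add, ← hr, div_mul_cancel₀ _ hz] at this
    linarith
  obtain ⟨q, hq⟩ := hBint
  refine ⟨F, by ext1 z; simpa using hdiag z, ?_, ?_⟩
  · rintro ⟨h0, h1, h2⟩
    have := hfU (fun i ↦ q - P i) (fun i ↦ by simpa using hq)
    rw [hFf, h0, h1, h2] at this
    simp at this
    linarith
  · intro i b hb
    let x : Fin 3 → Plane := Pi.single i (b - P i)
    let y : Fin 3 → Plane := fun i ↦ q - P i
    have hxB : ∀ j, P j + x j ∈ B := by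
      intro j
      by_cases hj : j = i
      · subst hj; simpa [x] using hb
      · simpa [x, hj] using hP j
    have hlim : Filter.Tendsto (fun t : ℝ ↦ f (x + t • (y - x))) (nhdsWithin 0 (Set.Ioi 0))
        (nhds (f x)) := by
      have : Continuous fun t : ℝ ↦ f (x + t • (y - x)) := by fun_prop
      simpa using (this.tendsto 0).mono_left nhdsWithin_le_nhds
    have hle : f x ≤ 0 := by
      refine le_of_tendsto hlim ?_
      filter_upwards [Ioc_mem_nhdsGT zero_lt_one] with t ht
      refine ((hfU _ fun j ↦ ?_).trans_le hu).le
      have := hB.convex.add_smul_sub_mem_interior (hxB j) (y := q) hq ht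
      have e : P j + (x + t • (y - x)) j = P j + x j + t • (q - (P j + x j)) := by
        simp only [Pi.add_apply, Pi.smul_apply, Pi.sub_apply, y]
        module
      rwa [e]
    have hfx : f x = F i (b - P i) := by simp [F, x]
    rw [hfx, map_sub] at hle
    linarith

/-- The largest homothet of a configuration fitting in `B` cannot be moved into the interior. -/
lemma exists_critical_homothet {B : Set Plane} (hB : IsBody B) (hBint : (interior B).Nonempty)
    {p : Fin 3 → Plane} (hfit : ∀ z, ∃ i, p i + z ∉ B) :
    ∃ (r : ℝ) (b : Plane), 0 < r ∧ r < 1 ∧ (∀ i, b + r • (p i - p 0) ∈ B) ∧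
      ∀ z, ∃ i, b + r • (p i - p 0) + z ∉ interior B := by
  let C : Set (ℝ × Plane) := (Set.Icc 0 1 ×ˢ B) ∩ ⋂ i, {x | x.2 + x.1 • (p i - p 0) ∈ B}
  have hC : IsCompact C := by
    refine (isCompact_Icc.prod hB.isCompact).inter_right (isClosed_iInter fun i ↦ ?_)
    exact hB.isCompact.isClosed.preimage
      (continuous_snd.add (continuous_fst.smul continuous_const))
  obtain ⟨c, hc⟩ := hBint
  have hCne : C.Nonempty :=
    ⟨(0, c), ⟨by simp, interior_subset hc⟩, by simpa using interior_subset hc⟩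
  obtain ⟨⟨r, b⟩, hrb, hmax⟩ := hC.exists_isMaxOn hCne continuous_fst.continuousOn
  obtain ⟨⟨⟨hr0, hr1⟩, hb⟩, hmem⟩ := hrb
  simp only [Set.mem_iInter, Set.mem_ofPred_eq] at hmem hr0 hr1 hb
  have hr1' : r < 1 := by
    refine lt_of_le_of_ne hr1 ?_
    rintro rfl
    obtain ⟨i, hi⟩ := hfit (b - p 0)
    apply hi
    convert hmem i using 1
    module
  have hcrit : ∀ z, ∃ i, b + r • (p i - p 0) + z ∉ interior B := by
    intro z
    by_contra! hz
    have hev : ∀ᶠ t in nhds r, ∀ i, b + t • (p i - p 0) + z ∈ interior B := by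
      refine Filter.eventually_all.2 fun i ↦ ?_
      have : Continuous fun t : ℝ ↦ b + t • (p i - p 0) + z := by fun_prop
      exact this.continuousAt.eventually_mem (isOpen_interior.mem_nhds (hz i))
    obtain ⟨t, ht, htr, ht1⟩ :=
      ((hev.filter_mono nhdsWithin_le_nhds).and (Ioo_mem_nhdsGT hr1')).exists
    have h0 := interior_subset (ht 0)
    have : (t, b + z) ∈ C := by
      refine ⟨⟨⟨hr0.trans htr.le, ht1.le⟩, by simpa using h0⟩, ?_⟩
      simp only [Set.mem_iInter, Set.mem_ofPred_eq]
      intro i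
      convert interior_subset (ht i) using 1
      abel
    exact (hmax this).not_gt htr
  refine ⟨r, b, lt_of_le_of_ne hr0 ?_, hr1', hmem, hcrit⟩
  rintro rfl
  obtain ⟨i, hi⟩ := hcrit (c - b)
  exact hi (by simpa using hc)

lemma area_le_of_wbtw {S B : Set Plane} (hS : IsBody S) (hB : IsBody B) {a b c : Plane}
    (ha : a ∈ S) (hc : c ∈ S) (h : Wbtw ℝ a b c)
    (hfit : ∀ z, a + z ∈ B → b + z ∈ B → c + z ∉ B) : area B ≤ 2 * mixedVol S B := by
  refine area_le_of_pair hS hB ha hc fun z hz hz' ↦ ?_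
  have haB : a + (z - a) ∈ B := by simpa using interior_subset hz
  have hcB : c + (z - a) ∈ B := by
    convert interior_subset hz' using 1
    abel
  refine hfit (z - a) haB ?_ hcB
  obtain ⟨t, ht, rfl⟩ := h
  convert hB.convex.add_smul_sub_mem haB hcB ht using 1
  rw [AffineMap.lineMap_apply_module']
  module

/-- If three points of `K` do not simultaneously fit in a translate of `B`, then `V(K, B)` is at
least half the area of `B`. -/
lemma area_le_of_forall_exists_notMem {K B : Set Plane} (hK : IsBody K) (hB : IsBody B)
    {p : Fin 3 → Plane} (hp : ∀ i, p i ∈ K) (hfit : ∀ z, ∃ i, p i + z ∉ B) :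
    area B ≤ 2 * mixedVol K B := by
  have hfit' : ∀ z, p 0 + z ∈ B → p 1 + z ∈ B → p 2 + z ∉ B := by
    intro z h0 h1 h2
    obtain ⟨i, hi⟩ := hfit z
    fin_cases i <;> contradiction
  rcases (interior B).eq_empty_or_nonempty with hBint | hBint
  · have := mixedVol_nonneg hK hB
    rw [← area_interior hB.convex, hBint]
    simpa [area] using this
  by_cases hli : LinearIndependent ℝ ![p 1 - p 0, p 2 - p 0]
  · obtain ⟨r, b, hr0, hr1, hmem, hcrit⟩ := exists_critical_homothet hB hBint hfit
    obtain ⟨F, hsum, hne, hF⟩ := exists_normals hB hBint hmem hcrit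
    have hli' : LinearIndependent ℝ ![(b + r • (p 1 - p 0)) - (b + r • (p 0 - p 0)),
        (b + r • (p 2 - p 0)) - (b + r • (p 0 - p 0))] := by
      simp only [add_sub_add_left_eq_sub, sub_self, smul_zero, sub_zero]
      rw [LinearIndependent.pair_iff] at hli ⊢
      intro s t hst
      have := hli (s * r) (t * r) (by simpa [mul_smul] using hst)
      simpa [hr0.ne'] using this
    have key := area_le_of_normals hB hli' (hmem 0) (hmem 1) (hmem 2) hsum hne (hF 0) (hF 1) (hF 2)
    have hsub : convexHull ℝ {b + r • (p 0 - p 0), b + r • (p 1 - p 0), b + r • (p 2 - p 0)} ⊆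
        {b - r • p 0} + r • K := by
      have : ∀ i, b + r • (p i - p 0) ∈ {b - r • p 0} + r • K := fun i ↦ by
        rw [mem_singleton_add_iff]
        convert Set.smul_mem_smul_set (hp i) (a := r) using 1
        module
      refine convexHull_min ?_ ((IsBody.singleton _).add (hK.smul r)).convex
      rintro x (rfl | rfl | rfl) <;> exact this _
    have hmono := mixedVol_mono (.convexHull_finite (by simp) (by simp))
      ((IsBody.singleton (b - r • p 0)).add (hK.smul r)) hB hsub
    rw [mixedVol_singleton_add, hB.isHomogeneous K hK r hr0] at hmono
    nlinarith [mixedVol_nonneg hK hB]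
  · have hcol : Collinear ℝ {p 0, p 1, p 2} := by
      by_cases h10 : p 1 - p 0 = 0
      · rw [sub_eq_zero.1 h10]
        simpa using collinear_pair ℝ (p 0) (p 2)
      · rw [LinearIndependent.pair_iff' h10] at hli
        push Not at hli
        obtain ⟨t, ht⟩ := hli
        rw [collinear_iff_of_mem (p₀ := p 0) (by simp)]
        refine ⟨p 1 - p 0, ?_⟩
        rintro x (rfl | rfl | rfl)
        · exact ⟨0, by simp⟩
        · exact ⟨1, by simp⟩
        · exact ⟨t, by simp [ht]⟩
    rcases hcol.wbtw_or_wbtw_or_wbtw with h | h | h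
    · exact area_le_of_wbtw hK hB (hp 0) (hp 2) h hfit'
    · exact area_le_of_wbtw hK hB (hp 1) (hp 0) h fun z h1 h2 h0 ↦ hfit' z h0 h1 h2
    · exact area_le_of_wbtw hK hB (hp 2) (hp 1) h fun z h2 h0 h1 ↦ hfit' z h0 h1 h2

/-- Helly's theorem for translates. -/
lemma exists_translate_subset {K A : Set Plane} (hA : IsBody A)
    (h : ∀ p : Fin 3 → Plane, (∀ i, p i ∈ K) → ∃ z, ∀ i, p i + z ∈ A) :
    ∃ z, {z} + K ⊆ A := by
  have heq : ∀ k : K, {z | (k : Plane) + z ∈ A} = {-(k : Plane)} + A := fun k ↦ by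
    ext z
    rw [mem_singleton_add_iff, sub_neg_eq_add, add_comm z, Set.mem_ofPred_eq]
  have hbody : ∀ k : K, IsBody {z | (k : Plane) + z ∈ A} := fun k ↦ by
    rw [heq]
    exact (IsBody.singleton _).add hA
  obtain ⟨z, hz⟩ := Convex.helly_theorem_compact' (𝕜 := ℝ)
    (fun k ↦ (hbody k).convex) (fun k ↦ (hbody k).isCompact) (fun I hI ↦ by
      rcases I.eq_empty_or_nonempty with rfl | hne
      · simp
      have := hne.to_subtype
      rw [finrank_euclideanSpace_fin] at hI
      obtain ⟨e⟩ := Function.Embedding.nonempty_of_card_le (α := I) (β := Fin 3) (by simpa using hI)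
      obtain ⟨z, hz⟩ := h (fun i ↦ (Function.invFun e i).1) fun i ↦ (Function.invFun e i).1.2
      refine ⟨z, Set.mem_iInter₂.2 fun k hk ↦ ?_⟩
      obtain ⟨i, hi⟩ := Function.invFun_surjective e.injective ⟨k, hk⟩
      simpa [hi] using hz i)
  refine ⟨z, ?_⟩
  rintro x hx
  rw [mem_singleton_add_iff] at hx
  simpa using Set.mem_iInter.1 hz ⟨x - z, hx⟩

/-- If `K` is too small to obstruct fitting in `s • A`, then it does fit. -/
lemma mixedVol_le_of_lt {K T A : Set Plane} (hK : IsBody K) (hT : IsBody T) (hA : IsBody A)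
    {s : ℝ} (hs : 0 < s) (h : 2 * mixedVol K A < s * area A) :
    mixedVol K T ≤ s * mixedVol A T := by
  obtain ⟨z, hz⟩ : ∃ z, {z} + K ⊆ s • A := by
    apply exists_translate_subset (hA.smul s)
    by_contra! hfit
    obtain ⟨p, hp, hfit⟩ := hfit
    have := area_le_of_forall_exists_notMem hK (hA.smul s) hp hfit
    rw [area_smul, mixedVol_comm, hK.isHomogeneous A hA s hs, mixedVol_comm] at this
    nlinarith
  have := mixedVol_mono ((IsBody.singleton z).add hK) (hA.smul s) hT hz
  rwa [mixedVol_singleton_add, hT.isHomogeneous A hA s hs] at this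

theorem planar_mixedVol_ineq
    {K T A : Set (EuclideanSpace ℝ (Fin 2))}
    (hK : Convex ℝ K) (hKc : IsCompact K) (hKne : K.Nonempty)
    (hT : Convex ℝ T) (hTc : IsCompact T) (hTne : T.Nonempty)
    (hA : Convex ℝ A) (hAc : IsCompact A) (hAne : A.Nonempty) :
    mixedVol K A * mixedVol T A ≥ (1 / 2) * mixedVol K T * mixedVol A A := by
  have bK : IsBody K := ⟨hK, hKc, hKne⟩
  have bT : IsBody T := ⟨hT, hTc, hTne⟩
  have bA : IsBody A := ⟨hA, hAc, hAne⟩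
  have hKA := mixedVol_nonneg bK bA
  have hTA := mixedVol_nonneg bT bA
  rw [mixedVol_self bA]
  rcases (area_nonneg A).eq_or_lt with h0 | h0
  · rw [← h0, mul_zero]
    exact mul_nonneg hKA hTA
  have hle : mixedVol K T ≤ 2 * mixedVol K A / area A * mixedVol A T := by
    have hlim : Filter.Tendsto (fun s : ℝ ↦ s * mixedVol A T)
        (nhdsWithin (2 * mixedVol K A / area A) (Set.Ioi (2 * mixedVol K A / area A)))
        (nhds (2 * mixedVol K A / area A * mixedVol A T)) :=
      ((continuous_id.mul continuous_const).tendsto _).mono_left nhdsWithin_le_nhds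
    refine ge_of_tendsto hlim ?_
    filter_upwards [self_mem_nhdsWithin] with s hs
    rw [Set.mem_Ioi] at hs
    exact mixedVol_le_of_lt bK bT bA (lt_of_le_of_lt (by positivity) hs) ((div_lt_iff₀ h0).1 hs)
  rw [mixedVol_comm A T, div_mul_eq_mul_div, le_div_iff₀ h0] at hle
  linarith
end

section
/- For planar convex bodies T, the perimeter satisfies L(T) ≥ 4R(T), where R(T) is the circumradius of T (the smallest radius of a closed disk containing T); equality holds if and only if T is a line segment. -/
open MeasureTheory Pointwise

/-- The perimeter of a planar convex body, `L(T) = 2 V(T, B)` with `B` the unit disk. -/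
noncomputable def perim (T : Set (EuclideanSpace ℝ (Fin 2))) : ℝ :=
  2 * mixedVol T (Metric.closedBall (0 : EuclideanSpace ℝ (Fin 2)) 1)

/-- The circumradius of a planar set: the smallest radius of a closed disk containing it. -/
noncomputable def circumradius (T : Set (EuclideanSpace ℝ (Fin 2))) : ℝ :=
  sInf {r : ℝ | ∃ c : EuclideanSpace ℝ (Fin 2), T ⊆ Metric.closedBall c r}

/-- The support function of a set. -/
noncomputable def supportFun (T : Set (EuclideanSpace ℝ (Fin 2)))
    (ξ : EuclideanSpace ℝ (Fin 2)) : ℝ := sSup (Set.image (inner ℝ ξ) T)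

/-- The width of a set with respect to a (not necessarily unit) covector. -/
noncomputable def width (T : Set (EuclideanSpace ℝ (Fin 2)))
    (ξ : EuclideanSpace ℝ (Fin 2)) : ℝ := supportFun T ξ + supportFun T (-ξ)

/-- Rotation of the plane by a right angle. -/
noncomputable def rot (v : EuclideanSpace ℝ (Fin 2)) : EuclideanSpace ℝ (Fin 2) :=
  !₂[-v 1, v 0]

section SupportFunction

variable {T S : Set (EuclideanSpace ℝ (Fin 2))}

lemma inner_le_supportFun (hT : IsCompact T) (ξ : EuclideanSpace ℝ (Fin 2))
    {x : EuclideanSpace ℝ (Fin 2)} (hx : x ∈ T) : inner ℝ ξ x ≤ supportFun T ξ :=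
  le_csSup (hT.bddAbove_image (by fun_prop)) (Set.mem_image_of_mem _ hx)

lemma exists_inner_eq_supportFun (hT : IsCompact T) (hne : T.Nonempty)
    (ξ : EuclideanSpace ℝ (Fin 2)) : ∃ x ∈ T, inner ℝ ξ x = supportFun T ξ := by
  obtain ⟨x, hx, h⟩ := hT.exists_sSup_image_eq hne
    (f := fun x => inner ℝ ξ x) (by fun_prop)
  exact ⟨x, hx, h.symm⟩

lemma supportFun_le (hne : T.Nonempty) {ξ : EuclideanSpace ℝ (Fin 2)} {r : ℝ}
    (h : ∀ x ∈ T, inner ℝ ξ x ≤ r) : supportFun T ξ ≤ r :=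
  csSup_le (hne.image _) (by rintro _ ⟨x, hx, rfl⟩; exact h x hx)

lemma supportFun_add (hT : IsCompact T) (hTne : T.Nonempty) (hS : IsCompact S)
    (hSne : S.Nonempty) (ξ : EuclideanSpace ℝ (Fin 2)) :
    supportFun (T + S) ξ = supportFun T ξ + supportFun S ξ := by
  apply le_antisymm
  · refine supportFun_le (hTne.add hSne) ?_
    rintro _ ⟨x, hx, y, hy, rfl⟩
    simp only [inner_add_right]
    exact add_le_add (inner_le_supportFun hT ξ hx) (inner_le_supportFun hS ξ hy)
  · obtain ⟨x, hx, hx'⟩ := exists_inner_eq_supportFun hT hTne ξ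
    obtain ⟨y, hy, hy'⟩ := exists_inner_eq_supportFun hS hSne ξ
    rw [← hx', ← hy', ← inner_add_right]
    exact inner_le_supportFun (hT.add hS) ξ (Set.add_mem_add hx hy)

lemma supportFun_smul (hT : IsCompact T) (hTne : T.Nonempty) {c : ℝ} (hc : 0 ≤ c)
    (ξ : EuclideanSpace ℝ (Fin 2)) : supportFun T (c • ξ) = c * supportFun T ξ := by
  apply le_antisymm
  · refine supportFun_le hTne fun x hx => ?_
    rw [real_inner_smul_left]
    exact mul_le_mul_of_nonneg_left (inner_le_supportFun hT ξ hx) hc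
  · obtain ⟨x, hx, hx'⟩ := exists_inner_eq_supportFun hT hTne ξ
    rw [← hx', ← real_inner_smul_left]
    exact inner_le_supportFun hT _ hx

lemma continuous_supportFun (hT : IsCompact T) : Continuous (supportFun T) :=
  hT.continuous_sSup (f := fun ξ x => inner ℝ ξ x) (by fun_prop)

lemma isCompact_segment (a b : EuclideanSpace ℝ (Fin 2)) : IsCompact (segment ℝ a b) := by
  rw [← convexHull_pair]; exact (Set.toFinite _).isCompact_convexHull ℝ

lemma supportFun_segment (a b ξ : EuclideanSpace ℝ (Fin 2)) :
    supportFun (segment ℝ a b) ξ = max (inner ℝ ξ a) (inner ℝ ξ b) := by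
  have hc := isCompact_segment a b
  apply le_antisymm
  · refine supportFun_le ⟨a, left_mem_segment ℝ a b⟩ ?_
    rintro _ ⟨s, t, hs, ht, hst, rfl⟩
    rw [inner_add_right, real_inner_smul_right, real_inner_smul_right]
    calc s * inner ℝ ξ a + t * inner ℝ ξ b
        ≤ s * max (inner ℝ ξ a) (inner ℝ ξ b) + t * max (inner ℝ ξ a) (inner ℝ ξ b) := by
          gcongr
          · exact le_max_left _ _
          · exact le_max_right _ _
      _ = _ := by rw [← add_mul, hst, one_mul]
  · exact max_le (inner_le_supportFun hc ξ (left_mem_segment ℝ a b))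
      (inner_le_supportFun hc ξ (right_mem_segment ℝ a b))

lemma exists_supportFun_lt_inner (hT : Convex ℝ T) (hTc : IsCompact T) (hTne : T.Nonempty)
    {x : EuclideanSpace ℝ (Fin 2)} (hx : x ∉ T) :
    ∃ ξ, supportFun T ξ < inner ℝ ξ x := by
  obtain ⟨f, u, hf, hu⟩ := geometric_hahn_banach_closed_point hT hTc.isClosed hx
  refine ⟨(InnerProductSpace.toDual ℝ _).symm f, ?_⟩
  obtain ⟨y, hy, hy'⟩ := exists_inner_eq_supportFun hTc hTne
    ((InnerProductSpace.toDual ℝ (EuclideanSpace ℝ (Fin 2))).symm f)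
  rw [← hy', InnerProductSpace.toDual_symm_apply, InnerProductSpace.toDual_symm_apply]
  exact (hf y hy).trans hu

lemma width_add (hT : IsCompact T) (hTne : T.Nonempty) (hS : IsCompact S)
    (hSne : S.Nonempty) (ξ : EuclideanSpace ℝ (Fin 2)) :
    width (T + S) ξ = width T ξ + width S ξ := by
  simp only [width, supportFun_add hT hTne hS hSne]; ring

lemma width_smul (hT : IsCompact T) (hTne : T.Nonempty) (c : ℝ)
    (ξ : EuclideanSpace ℝ (Fin 2)) : width T (c • ξ) = |c| * width T ξ := by
  rcases le_total 0 c with hc | hc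
  · rw [width, ← smul_neg, supportFun_smul hT hTne hc, supportFun_smul hT hTne hc,
      abs_of_nonneg hc, width]
    ring
  · have h : c • ξ = (-c) • (-ξ) := by simp
    have h' : -(c • ξ) = (-c) • ξ := by simp
    rw [width, h', h, supportFun_smul hT hTne (neg_nonneg.2 hc),
      supportFun_smul hT hTne (neg_nonneg.2 hc), abs_of_nonpos hc, width]
    ring

lemma width_segment (a b ξ : EuclideanSpace ℝ (Fin 2)) :
    width (segment ℝ a b) ξ = |inner ℝ (b - a) ξ| := by
  rw [width, supportFun_segment, supportFun_segment, inner_neg_left, inner_neg_left,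
    real_inner_comm ξ (b - a), inner_sub_right]
  rcases le_total (inner ℝ ξ a) (inner ℝ ξ b) with h | h
  · rw [max_eq_right h, max_eq_left (by linarith), abs_of_nonneg (by linarith)]; ring
  · rw [max_eq_left h, max_eq_right (by linarith), abs_of_nonpos (by linarith)]; ring

lemma image_inner_eq_Icc (hT : Convex ℝ T) (hTc : IsCompact T) (hTne : T.Nonempty)
    (ξ : EuclideanSpace ℝ (Fin 2)) :
    (fun x => inner ℝ ξ x) '' T = Set.Icc (-supportFun T (-ξ)) (supportFun T ξ) := by
  apply Set.Subset.antisymm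
  · rintro _ ⟨x, hx, rfl⟩
    have h := inner_le_supportFun hTc (-ξ) hx
    rw [inner_neg_left] at h
    exact ⟨by linarith, inner_le_supportFun hTc ξ hx⟩
  · obtain ⟨x, hx, hx'⟩ := exists_inner_eq_supportFun hTc hTne ξ
    obtain ⟨y, hy, hy'⟩ := exists_inner_eq_supportFun hTc hTne (-ξ)
    rw [← hx', ← hy', inner_neg_left, neg_neg]
    exact ((hT.isPreconnected.image _ (by fun_prop)).ordConnected).out
      (Set.mem_image_of_mem _ hy) (Set.mem_image_of_mem _ hx)

end SupportFunction

section Cavalieri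

lemma inner_rot_left (v w : EuclideanSpace ℝ (Fin 2)) :
    inner ℝ (rot v) w = v 0 * w 1 - v 1 * w 0 := by
  simp [rot, PiLp.inner_apply, Fin.sum_univ_two]; ring

lemma rot_smul (c : ℝ) (v : EuclideanSpace ℝ (Fin 2)) : rot (c • v) = c • rot v := by
  ext i; fin_cases i <;> simp [rot]

lemma norm_rot (v : EuclideanSpace ℝ (Fin 2)) : ‖rot v‖ = ‖v‖ := by
  simp [rot, EuclideanSpace.norm_eq, Fin.sum_univ_two, add_comm]

lemma inner_rot_self (v : EuclideanSpace ℝ (Fin 2)) : inner ℝ (rot v) v = 0 := by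
  rw [inner_rot_left]; ring

lemma orthonormal_rot {e : EuclideanSpace ℝ (Fin 2)} (he : ‖e‖ = 1) :
    Orthonormal ℝ ![rot e, e] := by
  refine ⟨fun i => ?_, fun i j hij => ?_⟩
  · fin_cases i <;> simp [norm_rot, he]
  · fin_cases i <;> fin_cases j <;>
      simp_all [inner_rot_self, real_inner_comm (rot e) e]

lemma measurePreserving_rot_frame {e : EuclideanSpace ℝ (Fin 2)} (he : ‖e‖ = 1) :
    MeasurePreserving (fun p : ℝ × ℝ => p.1 • rot e + p.2 • e) volume volume := by
  have ho := orthonormal_rot he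
  let b : OrthonormalBasis (Fin 2) ℝ (EuclideanSpace ℝ (Fin 2)) :=
    OrthonormalBasis.mk ho
      (ho.linearIndependent.span_eq_top_of_card_eq_finrank' (by simp)).ge
  have h := (b.measurePreserving_repr_symm.comp (PiLp.volume_preserving_toLp (Fin 2))).comp
    (volume_preserving_finTwoArrow ℝ).symm
  convert h using 1
  ext1 p
  simp only [Function.comp_apply]
  rw [← b.sum_repr_symm]
  simp [Fin.sum_univ_two, b, MeasurableEquiv.finTwoArrow]

lemma volume_slice {e : EuclideanSpace ℝ (Fin 2)} (he : ‖e‖ = 1)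
    {S : Set (EuclideanSpace ℝ (Fin 2))} (hS : MeasurableSet S) :
    volume S = ∫⁻ s : ℝ, volume {t : ℝ | s • rot e + t • e ∈ S} := by
  have h := measurePreserving_rot_frame he
  rw [← h.measure_preimage hS.nullMeasurableSet, Measure.volume_eq_prod,
    Measure.prod_apply (h.measurable hS)]
  rfl

lemma rot_decomp (v x : EuclideanSpace ℝ (Fin 2)) :
    inner ℝ (rot v) x • rot v + inner ℝ v x • v = ‖v‖ ^ 2 • x := by
  rw [EuclideanSpace.real_norm_sq_eq, Fin.sum_univ_two]
  ext i
  fin_cases i <;> simp [rot, PiLp.inner_apply, Fin.sum_univ_two] <;> ring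

lemma rot_frame_decomp {e : EuclideanSpace ℝ (Fin 2)} (he : ‖e‖ = 1)
    (x : EuclideanSpace ℝ (Fin 2)) :
    inner ℝ (rot e) x • rot e + inner ℝ e x • e = x := by
  rw [rot_decomp, he, one_pow, one_smul]

lemma mem_segment_neg_smul {e x : EuclideanSpace ℝ (Fin 2)} {l : ℝ} (hl : 0 ≤ l) :
    x ∈ segment ℝ (-(l • e)) (l • e) ↔ ∃ t : ℝ, |t| ≤ l ∧ t • e = x := by
  constructor
  · rintro ⟨a, b, ha, hb, hab, rfl⟩
    refine ⟨(b - a) * l, abs_le.2 ⟨by nlinarith, by nlinarith⟩, by module⟩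
  · rintro ⟨t, ht, rfl⟩
    rcases hl.eq_or_lt with rfl | hl
    · have : t = 0 := by simpa using ht
      simp [this]
    · rw [abs_le] at ht
      refine ⟨(1 - t / l) / 2, (1 + t / l) / 2, ?_, ?_, by ring, ?_⟩
      · have : t / l ≤ 1 := (div_le_one hl).2 ht.2
        linarith
      · have : -1 ≤ t / l := by rw [le_div_iff₀ hl]; linarith
        linarith
      · rw [smul_neg, smul_smul, smul_smul, ← neg_smul, ← add_smul]
        congr 1; field_simp; ring

lemma volume_slice_add_segment {e : EuclideanSpace ℝ (Fin 2)} {l : ℝ} (hl : 0 ≤ l)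
    (he : ‖e‖ = 1) {T : Set (EuclideanSpace ℝ (Fin 2))}
    (hT : Convex ℝ T) (hTc : IsCompact T) (s : ℝ) :
    volume {t : ℝ | s • rot e + t • e ∈ T + segment ℝ (-(l • e)) (l • e)} =
      volume {t : ℝ | s • rot e + t • e ∈ T} +
        ((fun x => inner ℝ (rot e) x) '' T).indicator
          (fun _ => ENNReal.ofReal (2 * l)) s := by
  set A : Set ℝ := {t : ℝ | s • rot e + t • e ∈ T} with hA
  have hB : {t : ℝ | s • rot e + t • e ∈ T + segment ℝ (-(l • e)) (l • e)} =
      {t | ∃ t' ∈ A, |t - t'| ≤ l} := by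
    ext t
    constructor
    · rintro ⟨x, hx, y, hy, hxy⟩
      obtain ⟨r, hr, rfl⟩ := (mem_segment_neg_smul hl).1 hy
      refine ⟨t - r, ?_, by simpa using hr⟩
      have : x = s • rot e + (t - r) • e := by
        simp only at hxy
        rw [sub_smul, ← add_sub_assoc, ← hxy, add_sub_cancel_right]
      simpa [hA, ← this] using hx
    · rintro ⟨t', ht', h⟩
      exact ⟨_, ht', (t - t') • e, (mem_segment_neg_smul hl).2 ⟨_, h, rfl⟩, by module⟩
  have hI : s ∈ ((fun x => inner ℝ (rot e) x) '' T) ↔ A.Nonempty := by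
    constructor
    · rintro ⟨x, hx, rfl⟩
      exact ⟨inner ℝ e x, by simpa [hA, rot_frame_decomp he] using hx⟩
    · rintro ⟨t, ht⟩
      refine ⟨_, ht, ?_⟩
      simp [inner_add_right, real_inner_smul_right, inner_rot_self, norm_rot, he]
  rw [hB]
  by_cases hne : A.Nonempty
  · have hAc : IsCompact A := by
      have himg : A = (fun x => inner ℝ e x) '' (T ∩ {x | inner ℝ (rot e) x = s}) := by
        ext t
        constructor
        · intro ht
          refine ⟨_, ⟨ht, ?_⟩, ?_⟩
          · simp [inner_add_right, real_inner_smul_right, inner_rot_self, norm_rot, he]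
          · simp [inner_add_right, real_inner_smul_right, real_inner_comm (rot e) e,
              inner_rot_self, he]
        · rintro ⟨x, ⟨hx, rfl⟩, rfl⟩
          simpa [hA, rot_frame_decomp he] using hx
      rw [himg]
      exact (hTc.inter_right (isClosed_eq (by fun_prop) (by fun_prop))).image (by fun_prop)
    have hAconv : Convex ℝ A := by
      intro t ht t' ht' a b ha hb hab
      have := hT ht ht' ha hb hab
      simp only [hA, Set.mem_ofPred_eq]
      convert this using 1
      simp only [smul_add, smul_smul, smul_eq_mul, add_smul]
      have : s • rot e = (a * s) • rot e + (b * s) • rot e := by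
        rw [← add_smul, ← add_mul, hab, one_mul]
      rw [this]; abel
    have hIcc := eq_Icc_of_connected_compact ⟨hne, hAconv.isPreconnected⟩ hAc
    set a := sInf A
    set b := sSup A
    have hab : a ≤ b := by
      rw [hIcc] at hne; exact Set.nonempty_Icc.1 hne
    have : {t | ∃ t' ∈ A, |t - t'| ≤ l} = Set.Icc (a - l) (b + l) := by
      rw [hIcc]
      ext t
      constructor
      · rintro ⟨t', ht', h⟩
        rw [abs_le] at h
        exact ⟨by linarith [ht'.1], by linarith [ht'.2]⟩
      · rintro ⟨h1, h2⟩
        refine ⟨max a (min t b), ⟨le_max_left _ _, max_le hab (min_le_right _ _)⟩, ?_⟩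
        rw [abs_le]
        constructor
        · rcases max_cases a (min t b) with h | h <;> rcases min_cases t b with h' | h' <;>
            linarith
        · rcases max_cases a (min t b) with h | h <;> rcases min_cases t b with h' | h' <;>
            linarith
    rw [this, Set.indicator_of_mem (hI.2 hne), hIcc, Real.volume_Icc, Real.volume_Icc,
      ← ENNReal.ofReal_add (by linarith) (by linarith)]
    congr 1; ring
  · rw [Set.indicator_of_notMem (mt hI.1 hne), Set.not_nonempty_iff_eq_empty.1 hne]
    simp

lemma area_add_segment {T : Set (EuclideanSpace ℝ (Fin 2))}
    (hT : Convex ℝ T) (hTc : IsCompact T) (hTne : T.Nonempty)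
    (v : EuclideanSpace ℝ (Fin 2)) :
    area (T + segment ℝ (-v) v) = area T + 2 * width T (rot v) := by
  rcases eq_or_ne v 0 with rfl | hv
  · have : width T (rot 0) = 0 := by
      have := width_smul hTc hTne 0 (rot 0)
      rwa [← rot_smul, zero_smul, abs_zero, zero_mul] at this
    simp [this]
  set l := ‖v‖ with hl
  have hl0 : 0 < l := norm_pos_iff.2 hv
  set e := l⁻¹ • v with he'
  have he : ‖e‖ = 1 := by
    rw [he', norm_smul, norm_inv, Real.norm_of_nonneg hl0.le, ← hl, inv_mul_cancel₀ hl0.ne']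
  have hve : v = l • e := by rw [he', smul_smul, mul_inv_cancel₀ hl0.ne', one_smul]
  rw [hve, rot_smul, width_smul hTc hTne, abs_of_pos hl0]
  have hIcc := image_inner_eq_Icc hT hTc hTne (rot e)
  have hw : 0 ≤ width T (rot e) := by
    have := (hTne.image (fun x => inner ℝ (rot e) x))
    rw [hIcc, Set.nonempty_Icc] at this
    rw [width]; linarith
  have key : volume (T + segment ℝ (-(l • e)) (l • e)) =
      volume T + ENNReal.ofReal (2 * l) * ENNReal.ofReal (width T (rot e)) := by
    rw [volume_slice he (hTc.add (isCompact_segment _ _)).measurableSet,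
      volume_slice he hTc.measurableSet]
    simp_rw [volume_slice_add_segment hl0.le he hT hTc]
    rw [lintegral_add_right, hIcc, lintegral_indicator_const measurableSet_Icc,
      Real.volume_Icc, width]
    · congr 3; ring
    · rw [hIcc]; exact measurable_const.indicator measurableSet_Icc
  rw [area, key, ENNReal.toReal_add hTc.measure_lt_top.ne (by finiteness),
    ENNReal.toReal_mul, ENNReal.toReal_ofReal (by positivity), ENNReal.toReal_ofReal hw, area]
  ring

end Cavalieri

section Zonogon

/-- The Minkowski sum of the first `n` of the segments `[-v j, v j]`. -/
noncomputable def zonogon (v : ℕ → EuclideanSpace ℝ (Fin 2)) (n : ℕ) :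
    Set (EuclideanSpace ℝ (Fin 2)) := ∑ j ∈ Finset.range n, segment ℝ (-v j) (v j)

variable (v : ℕ → EuclideanSpace ℝ (Fin 2)) (n : ℕ)

lemma zonogon_succ : zonogon v (n + 1) = zonogon v n + segment ℝ (-v n) (v n) :=
  Finset.sum_range_succ _ _

lemma convex_zonogon : Convex ℝ (zonogon v n) := by
  induction n with
  | zero =>
    rw [zonogon, Finset.sum_range_zero, ← Set.singleton_zero]
    exact convex_singleton 0
  | succ n ih => rw [zonogon_succ]; exact ih.add (convex_segment _ _)

lemma isCompact_zonogon : IsCompact (zonogon v n) := by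
  induction n with
  | zero => simp [zonogon]
  | succ n ih => rw [zonogon_succ]; exact ih.add (isCompact_segment _ _)

lemma zonogon_nonempty : (zonogon v n).Nonempty := by
  induction n with
  | zero => simp [zonogon]
  | succ n ih => rw [zonogon_succ]; exact ih.add ⟨_, left_mem_segment ℝ _ _⟩

lemma supportFun_zonogon (ξ : EuclideanSpace ℝ (Fin 2)) :
    supportFun (zonogon v n) ξ = ∑ j ∈ Finset.range n, |inner ℝ (v j) ξ| := by
  induction n with
  | zero => simp [zonogon, supportFun]
  | succ n ih =>
    rw [zonogon_succ, supportFun_add (isCompact_zonogon v n) (zonogon_nonempty v n)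
      (isCompact_segment _ _) ⟨_, left_mem_segment ℝ _ _⟩, ih, Finset.sum_range_succ,
      supportFun_segment, inner_neg_right, max_comm, real_inner_comm]
    rfl

lemma zonogon_subset_closedBall {r : ℝ}
    (h : ∀ ξ, ∑ j ∈ Finset.range n, |inner ℝ (v j) ξ| ≤ r * ‖ξ‖) :
    zonogon v n ⊆ Metric.closedBall 0 r := by
  intro x hx
  have h1 := inner_le_supportFun (isCompact_zonogon v n) x hx
  rw [supportFun_zonogon, real_inner_self_eq_norm_sq] at h1
  have h2 := h1.trans (h x)
  rw [mem_closedBall_zero_iff]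
  rcases (norm_nonneg x).eq_or_lt with h0 | h0
  · obtain ⟨w, hw⟩ := exists_ne (0 : EuclideanSpace ℝ (Fin 2))
    have h3 := (Finset.sum_nonneg fun j _ => abs_nonneg (inner ℝ (v j) w)).trans (h w)
    rw [← h0]
    exact nonneg_of_mul_nonneg_left h3 (norm_pos_iff.2 hw)
  · nlinarith

lemma closedBall_subset_zonogon
    (h : ∀ ξ, ‖ξ‖ ≤ ∑ j ∈ Finset.range n, |inner ℝ (v j) ξ|) :
    Metric.closedBall 0 1 ⊆ zonogon v n := by
  intro x hx
  rw [mem_closedBall_zero_iff] at hx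
  by_contra hxz
  obtain ⟨ξ, hξ⟩ := exists_supportFun_lt_inner (convex_zonogon v n) (isCompact_zonogon v n)
    (zonogon_nonempty v n) hxz
  rw [supportFun_zonogon] at hξ
  have := real_inner_le_norm ξ x
  nlinarith [h ξ, norm_nonneg ξ]

lemma area_add_zonogon {T : Set (EuclideanSpace ℝ (Fin 2))}
    (hT : Convex ℝ T) (hTc : IsCompact T) (hTne : T.Nonempty) :
    area (T + zonogon v n) = area T + area (zonogon v n) +
      2 * ∑ j ∈ Finset.range n, width T (rot (v j)) := by
  induction n with
  | zero => simp [zonogon, area, ← Set.singleton_zero]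
  | succ n ih =>
    rw [zonogon_succ, ← add_assoc, area_add_segment (hT.add (convex_zonogon v n))
      (hTc.add (isCompact_zonogon v n)) (hTne.add (zonogon_nonempty v n)), ih,
      area_add_segment (convex_zonogon v n) (isCompact_zonogon v n) (zonogon_nonempty v n),
      width_add hTc hTne (isCompact_zonogon v n) (zonogon_nonempty v n),
      Finset.sum_range_succ]
    ring

end Zonogon

section RegularZonogon

open Real

lemma sum_sin_telescope (N n : ℕ) (ψ : ℝ) :
    (∑ j ∈ Finset.range n, sin (ψ + π / N * j)) * (2 * sin (π / (2 * N))) =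
      cos (ψ - π / (2 * N)) - cos (ψ + π / N * n - π / (2 * N)) := by
  induction n with
  | zero => simp
  | succ n ih =>
    rw [Finset.sum_range_succ, add_mul, ih]
    have h1 : ψ + π / N * ((n + 1 : ℕ) : ℝ) - π / (2 * N) =
        (ψ + π / N * n) + π / (2 * N) := by
      push_cast
      have : π / N = 2 * (π / (2 * N)) := by
        rcases eq_or_ne (N : ℝ) 0 with h | h
        · simp [h]
        · field_simp
      linear_combination this
    rw [h1, cos_add, cos_sub (ψ + π / N * n)]
    ring

lemma abs_sin_sum_bounds {N : ℕ} (hN : 2 ≤ N) (ψ : ℝ) :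
    cos (π / (2 * N)) ≤ (∑ j ∈ Finset.range N, |sin (ψ + π / N * j)|) * sin (π / (2 * N)) ∧
      (∑ j ∈ Finset.range N, |sin (ψ + π / N * j)|) * sin (π / (2 * N)) ≤ 1 := by
  have hN' : (2 : ℝ) ≤ N := by exact_mod_cast hN
  have hpos : 0 < π / N := by positivity
  have hper : Function.Periodic
      (fun ψ : ℝ => ∑ j ∈ Finset.range N, |sin (ψ + π / N * j)|) (π / N) := by
    intro ψ
    have h1 := Finset.sum_range_succ (fun j : ℕ => |sin (ψ + π / N * j)|) N
    have h2 := Finset.sum_range_succ' (fun j : ℕ => |sin (ψ + π / N * j)|) N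
    have h3 : ψ + π / N * N = ψ + π := by field_simp
    rw [h3, sin_add_pi, abs_neg] at h1
    simp only [Nat.cast_zero, mul_zero, add_zero] at h2
    have h4 : ∀ j : ℕ, ψ + π / N + π / N * j = ψ + π / N * ((j + 1 : ℕ) : ℝ) := by
      intro j; push_cast; ring
    simp only [h4]
    linarith
  obtain ⟨ψ', hψ', h⟩ := hper.exists_mem_Ico₀ hpos ψ
  rw [h]
  have habs : ∀ j ∈ Finset.range N, |sin (ψ' + π / N * j)| = sin (ψ' + π / N * j) := by
    intro j hj
    have hj' : (j : ℝ) + 1 ≤ N := by exact_mod_cast Finset.mem_range.1 hj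
    refine abs_of_nonneg (sin_nonneg_of_nonneg_of_le_pi ?_ ?_)
    · have := hψ'.1; positivity
    · calc ψ' + π / N * j ≤ π / N + π / N * j := by linarith [hψ'.2]
        _ = π / N * (j + 1) := by ring
        _ ≤ π / N * N := by gcongr
        _ = π := by field_simp
  rw [Finset.sum_congr rfl habs]
  have ht := sum_sin_telescope N N ψ'
  have h3 : ψ' + π / N * N - π / (2 * N) = ψ' - π / (2 * N) + π := by field_simp; ring
  rw [h3, cos_add_pi] at ht
  have hval : (∑ j ∈ Finset.range N, sin (ψ' + π / N * j)) * sin (π / (2 * N)) =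
      cos (ψ' - π / (2 * N)) := by linarith
  rw [hval]
  have hhalf : π / N = 2 * (π / (2 * N)) := by field_simp
  refine ⟨?_, cos_le_one _⟩
  rw [← cos_abs (ψ' - _)]
  apply cos_le_cos_of_nonneg_of_le_pi (abs_nonneg _)
  · rw [div_le_iff₀ (by positivity)]; nlinarith [pi_pos]
  · rw [abs_le]; constructor <;> linarith [hψ'.1, hψ'.2, pi_pos]

/-- The generators of a regular `2N`-gon circumscribed about the unit disk. -/
noncomputable def spoke (N j : ℕ) : EuclideanSpace ℝ (Fin 2) :=
  tan (π / (2 * N)) • !₂[cos (π / N * j), sin (π / N * j)]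

lemma cos_pi_div_pos {N : ℕ} (hN : 2 ≤ N) : 0 < cos (π / (2 * N)) := by
  have hN' : (2 : ℝ) ≤ N := by exact_mod_cast hN
  apply cos_pos_of_mem_Ioo
  constructor
  · have : 0 < π / (2 * N) := by positivity
    linarith [pi_pos]
  · apply div_lt_div_of_pos_left pi_pos (by norm_num); linarith

lemma sum_abs_inner_spoke {N : ℕ} (hN : 2 ≤ N) (u : EuclideanSpace ℝ (Fin 2)) :
    ‖u‖ ≤ ∑ j ∈ Finset.range N, |inner ℝ (spoke N j) u| ∧
      ∑ j ∈ Finset.range N, |inner ℝ (spoke N j) u| ≤ (cos (π / (2 * N)))⁻¹ * ‖u‖ := by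
  have hN' : (2 : ℝ) ≤ N := by exact_mod_cast hN
  have hcos := cos_pi_div_pos hN
  have hsin : 0 ≤ sin (π / (2 * N)) := by
    apply sin_nonneg_of_nonneg_of_le_pi (by positivity)
    rw [div_le_iff₀ (by positivity)]; nlinarith [pi_pos]
  obtain ⟨φ, h0, h1⟩ : ∃ φ : ℝ, u 0 = ‖u‖ * cos φ ∧ u 1 = ‖u‖ * sin φ := by
    have hn : ‖u‖ = ‖(⟨u 0, u 1⟩ : ℂ)‖ := by
      rw [EuclideanSpace.norm_eq, Fin.sum_univ_two, Complex.norm_eq_sqrt_sq_add_sq]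
      simp
    refine ⟨Complex.arg ⟨u 0, u 1⟩, ?_, ?_⟩
    · rw [hn, Complex.norm_mul_cos_arg]
    · rw [hn, Complex.norm_mul_sin_arg]
  have hterm : ∀ j : ℕ, |inner ℝ (spoke N j) u| =
      ‖u‖ * tan (π / (2 * N)) * |sin ((π / 2 - φ) + π / N * j)| := by
    intro j
    have : inner ℝ (spoke N j) u =
        ‖u‖ * tan (π / (2 * N)) * sin ((π / 2 - φ) + π / N * j) := by
      have : (π / 2 - φ) + π / N * j = π / 2 - (φ - π / N * j) := by ring
      rw [this, sin_pi_div_two_sub, cos_sub]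
      simp [spoke, inner_smul_left, PiLp.inner_apply, Fin.sum_univ_two, h0, h1]
      ring
    rw [this, abs_mul, abs_of_nonneg]
    rw [tan_eq_sin_div_cos]; positivity
  simp_rw [hterm, ← Finset.mul_sum, tan_eq_sin_div_cos]
  obtain ⟨hl, hu⟩ := abs_sin_sum_bounds hN (π / 2 - φ)
  set F := ∑ j ∈ Finset.range N, |sin ((π / 2 - φ) + π / N * j)|
  have heq : ‖u‖ * (sin (π / (2 * N)) / cos (π / (2 * N))) * F =
      ‖u‖ * ((F * sin (π / (2 * N))) / cos (π / (2 * N))) := by ring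
  rw [heq]
  constructor
  · exact le_mul_of_one_le_right (norm_nonneg u) ((one_le_div hcos).2 hl)
  · rw [mul_comm (_)⁻¹, inv_eq_one_div]
    gcongr

lemma tendsto_inv_cos :
    Filter.Tendsto (fun n : ℕ => (cos (π / (2 * ((n + 2 : ℕ) : ℝ))))⁻¹) Filter.atTop
      (nhds 1) := by
  have h1 : Filter.Tendsto (fun n : ℕ => π / 2 / ((n + 2 : ℕ) : ℝ)) Filter.atTop (nhds 0) :=
    (Filter.tendsto_add_atTop_iff_nat 2).2 (tendsto_const_div_atTop_nhds_zero_nat (π / 2))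
  have h2 := ((continuous_cos.tendsto 0).comp h1).inv₀ (by simp)
  simp only [cos_zero, inv_one] at h2
  refine h2.congr fun n => ?_
  simp only [Function.comp_apply, div_div]

lemma tendsto_area_add_zonogon {K : Set (EuclideanSpace ℝ (Fin 2))} (hK : IsCompact K) :
    Filter.Tendsto (fun n : ℕ => area (K + zonogon (spoke (n + 2)) (n + 2))) Filter.atTop
      (nhds (area (K + Metric.closedBall 0 1))) := by
  have hKB : IsCompact (K + Metric.closedBall (0 : EuclideanSpace ℝ (Fin 2)) 1) :=
    hK.add (isCompact_closedBall 0 1)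
  have hδ : Filter.Tendsto (fun n : ℕ => (cos (π / (2 * ((n + 2 : ℕ) : ℝ))))⁻¹ - 1)
      Filter.atTop (nhds 0) := by simpa using tendsto_inv_cos.sub_const 1
  have hup := (ENNReal.tendsto_toReal hKB.measure_lt_top.ne).comp
    ((tendsto_measure_cthickening_of_isCompact (μ := volume) hKB).comp hδ)
  refine tendsto_of_tendsto_of_tendsto_of_le_of_le tendsto_const_nhds hup ?_ ?_
  · intro n
    apply ENNReal.toReal_mono (hK.add (isCompact_zonogon _ _)).measure_lt_top.ne
    gcongr
    exact closedBall_subset_zonogon _ _ fun ξ => (sum_abs_inner_spoke (by omega) ξ).1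
  · intro n
    apply ENNReal.toReal_mono hKB.cthickening.measure_lt_top.ne
    apply measure_mono
    rintro _ ⟨k, hk, z, hz, rfl⟩
    have hz' := zonogon_subset_closedBall _ _
      (fun ξ => (sum_abs_inner_spoke (N := n + 2) (by omega) ξ).2) hz
    have hcos := cos_pi_div_pos (N := n + 2) (by omega)
    set c := cos (π / (2 * ((n + 2 : ℕ) : ℝ)))
    rw [mem_closedBall_zero_iff] at hz'
    have hzc : c * ‖z‖ ≤ 1 := by
      calc c * ‖z‖ ≤ c * c⁻¹ := by gcongr
        _ = 1 := mul_inv_cancel₀ hcos.ne'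
    refine Metric.mem_cthickening_of_dist_le _ (k + c • z) _ _
      (Set.add_mem_add hk ?_) ?_
    · rw [mem_closedBall_zero_iff, norm_smul, Real.norm_of_nonneg hcos.le]
      exact hzc
    · have h1 : (1 : ℝ) - c ≥ 0 := by linarith [cos_le_one (π / (2 * ((n + 2 : ℕ) : ℝ)))]
      have : (k + z) - (k + c • z) = (1 - c) • z := by module
      rw [dist_eq_norm, this, norm_smul, Real.norm_of_nonneg h1]
      calc (1 - c) * ‖z‖ ≤ (1 - c) * c⁻¹ := by gcongr
        _ = c⁻¹ - 1 := by rw [sub_mul, mul_inv_cancel₀ hcos.ne', one_mul]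

/-- A Riemann sum for the integral of `g` over directions, in Cauchy's perimeter formula. -/
noncomputable def cauchySum (n : ℕ) (g : EuclideanSpace ℝ (Fin 2) → ℝ) : ℝ :=
  2 * ∑ j ∈ Finset.range (n + 2), g (rot (spoke (n + 2) j))

lemma tendsto_cauchySum_width {T : Set (EuclideanSpace ℝ (Fin 2))}
    (hT : Convex ℝ T) (hTc : IsCompact T) (hTne : T.Nonempty) :
    Filter.Tendsto (fun n => cauchySum n (width T)) Filter.atTop (nhds (perim T)) := by
  have h0 := tendsto_area_add_zonogon
    (isCompact_singleton (x := (0 : EuclideanSpace ℝ (Fin 2))))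
  simp only [Set.singleton_zero, zero_add] at h0
  have h := ((tendsto_area_add_zonogon hTc).sub_const (area T)).sub h0
  have hp : area (T + Metric.closedBall 0 1) - area T -
      area (Metric.closedBall (0 : EuclideanSpace ℝ (Fin 2)) 1) = perim T := by
    rw [perim, mixedVol]; ring
  rw [hp] at h
  refine h.congr fun n => ?_
  rw [area_add_zonogon _ _ hT hTc hTne, cauchySum]
  ring

lemma tendsto_cauchySum_abs_inner (x : EuclideanSpace ℝ (Fin 2)) :
    Filter.Tendsto (fun n => cauchySum n (fun ξ => |inner ℝ x ξ|)) Filter.atTop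
      (nhds (2 * ‖x‖)) := by
  have heq : ∀ n, cauchySum n (fun ξ => |inner ℝ x ξ|) =
      2 * ∑ j ∈ Finset.range (n + 2), |inner ℝ (spoke (n + 2) j) (rot x)| := by
    intro n
    rw [cauchySum]
    congr 1
    refine Finset.sum_congr rfl fun j _ => ?_
    rw [real_inner_comm, inner_rot_left, real_inner_comm, inner_rot_left, ← abs_neg]
    congr 1; ring
  simp_rw [heq]
  refine Filter.Tendsto.const_mul 2 ?_
  have hup := tendsto_inv_cos.mul_const ‖x‖
  rw [one_mul] at hup
  refine tendsto_of_tendsto_of_tendsto_of_le_of_le tendsto_const_nhds hup ?_ ?_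
  · intro n
    simpa only [norm_rot] using (sum_abs_inner_spoke (N := n + 2) (by omega) (rot x)).1
  · intro n
    simpa only [norm_rot] using (sum_abs_inner_spoke (N := n + 2) (by omega) (rot x)).2

lemma cauchySum_mono (n : ℕ) {f g : EuclideanSpace ℝ (Fin 2) → ℝ} (h : ∀ ξ, f ξ ≤ g ξ) :
    cauchySum n f ≤ cauchySum n g :=
  mul_le_mul_of_nonneg_left (Finset.sum_le_sum fun _ _ => h _) zero_le_two

end RegularZonogon

section Strictness

lemma tendsto_cauchySum_sub {f g : EuclideanSpace ℝ (Fin 2) → ℝ} {a b : ℝ}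
    (hf : Filter.Tendsto (fun n => cauchySum n f) Filter.atTop (nhds a))
    (hg : Filter.Tendsto (fun n => cauchySum n g) Filter.atTop (nhds b)) :
    Filter.Tendsto (fun n => cauchySum n (fun ξ => f ξ - g ξ)) Filter.atTop
      (nhds (a - b)) := by
  refine (hf.sub hg).congr fun n => ?_
  simp only [cauchySum, Finset.sum_sub_distrib]; ring

lemma tendsto_cauchySum_sum_abs_inner {ι : Type*} [Fintype ι] (w : ι → ℝ)
    (x : ι → EuclideanSpace ℝ (Fin 2)) :
    Filter.Tendsto (fun n => cauchySum n (fun ξ => ∑ i, w i * |inner ℝ (x i) ξ|))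
      Filter.atTop (nhds (2 * ∑ i, w i * ‖x i‖)) := by
  have h := tendsto_finsetSum Finset.univ
    (fun i _ => (tendsto_cauchySum_abs_inner (x i)).const_mul (w i))
  have heq : ∑ i, w i * (2 * ‖x i‖) = 2 * ∑ i, w i * ‖x i‖ := by
    rw [Finset.mul_sum]; exact Finset.sum_congr rfl fun i _ => by ring
  rw [heq] at h
  refine h.congr fun n => ?_
  simp only [cauchySum]
  rw [Finset.sum_comm, Finset.mul_sum]
  refine Finset.sum_congr rfl fun i _ => ?_
  rw [← Finset.mul_sum]; ring

lemma limit_cauchySum_pos {G : EuclideanSpace ℝ (Fin 2) → ℝ} {L : ℝ} (hG : Continuous G)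
    (hhom : ∀ (c : ℝ) ξ, G (c • ξ) = |c| * G ξ) (hnonneg : ∀ ξ, 0 ≤ G ξ)
    {ξ₀ : EuclideanSpace ℝ (Fin 2)} (hpos : 0 < G ξ₀)
    (hL : Filter.Tendsto (fun n => cauchySum n G) Filter.atTop (nhds L)) : 0 < L := by
  have hξ₀ : ξ₀ ≠ 0 := by
    rintro rfl
    have := hhom 0 0
    simp only [zero_smul, abs_zero, zero_mul] at this
    linarith
  have hn : 0 < ‖ξ₀‖ := norm_pos_iff.2 hξ₀
  set η := rot ξ₀ with hη
  obtain ⟨ε, hε, hs⟩ : ∃ ε > 0, ∀ s : ℝ, |s| < ε → G ξ₀ / 2 < G (ξ₀ + s • η) := by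
    have hc : Continuous fun s : ℝ => G (ξ₀ + s • η) := by fun_prop
    have hev : ∀ᶠ s in nhds (0 : ℝ), G ξ₀ / 2 < G (ξ₀ + s • η) :=
      hc.continuousAt.eventually_const_lt (by simpa using hpos)
    obtain ⟨ε, hε, h⟩ := Metric.eventually_nhds_iff.1 hev
    exact ⟨ε, hε, fun s hs => h (by simpa using hs)⟩
  set δ := G ξ₀ / 2 with hδ
  have hδ0 : 0 < δ := by positivity
  set k := δ / (2 * ε * ‖ξ₀‖ ^ 2) with hk
  have hk0 : 0 < k := by positivity
  have hbound : ∀ ξ, ∑ i, ![k, k, -k] i *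
      |inner ℝ (![η + ε • ξ₀, η - ε • ξ₀, (2 : ℝ) • η] i) ξ| ≤ G ξ := by
    intro ξ
    simp only [Fin.sum_univ_three, Matrix.cons_val, inner_add_left, inner_sub_left,
      real_inner_smul_left]
    have hdec := rot_decomp ξ₀ ξ
    rw [← hη] at hdec
    set a := inner ℝ ξ₀ ξ
    set b := inner ℝ η ξ
    rw [abs_mul 2 b, abs_of_pos (two_pos : (0 : ℝ) < 2)]
    rcases le_or_gt (ε * |a|) |b| with h | h
    · have : |b + ε * a| + |b - ε * a| = 2 * |b| := by
        have h' : |ε * a| ≤ |b| := by rwa [abs_mul, abs_of_pos hε]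
        rw [abs_le] at h'
        rcases abs_cases b with hb | hb
        · rw [abs_of_nonneg (by linarith), abs_of_nonneg (by linarith)]; linarith
        · rw [abs_of_nonpos (by linarith), abs_of_nonpos (by linarith)]; linarith
      have h0 : k * |b + ε * a| + k * |b - ε * a| + -k * (2 * |b|) = 0 := by
        linear_combination k * this
      rw [h0]; exact hnonneg ξ
    · have ha : a ≠ 0 := by
        intro ha
        rw [ha, abs_zero, mul_zero] at h
        exact absurd h (abs_nonneg b).not_gt
      have hξ : ξ = (a / ‖ξ₀‖ ^ 2) • (ξ₀ + (b / a) • η) := by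
        rw [smul_add, smul_smul, show a / ‖ξ₀‖ ^ 2 * (b / a) = (‖ξ₀‖ ^ 2)⁻¹ * b by field_simp,
          show a / ‖ξ₀‖ ^ 2 = (‖ξ₀‖ ^ 2)⁻¹ * a by field_simp, mul_smul, mul_smul,
          ← smul_add, add_comm, hdec, smul_smul, inv_mul_cancel₀ (by positivity), one_smul]
      have hGξ : |a| / ‖ξ₀‖ ^ 2 * δ ≤ G ξ := by
        rw [hξ, hhom, abs_div, abs_of_nonneg (sq_nonneg ‖ξ₀‖)]
        have hba : |b / a| < ε := by rwa [abs_div, div_lt_iff₀ (abs_pos.2 ha)]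
        exact mul_le_mul_of_nonneg_left (hs _ hba).le (by positivity)
      have h1 := abs_add_le b (ε * a)
      have h2 := abs_sub b (ε * a)
      rw [abs_mul ε a, abs_of_pos hε] at h1 h2
      calc k * |b + ε * a| + k * |b - ε * a| + -k * (2 * |b|)
          = k * (|b + ε * a| + |b - ε * a| - 2 * |b|) := by ring
        _ ≤ k * (2 * (ε * |a|)) := by gcongr; linarith
        _ = |a| / ‖ξ₀‖ ^ 2 * δ := by rw [hk]; field_simp
        _ ≤ G ξ := hGξ
  have hlim := le_of_tendsto_of_tendsto' (tendsto_cauchySum_sum_abs_inner ![k, k, -k]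
    ![η + ε • ξ₀, η - ε • ξ₀, (2 : ℝ) • η]) hL (fun n => cauchySum_mono n hbound)
  refine lt_of_lt_of_le ?_ hlim
  simp only [Fin.sum_univ_three, Matrix.cons_val, norm_smul, Real.norm_ofNat]
  have horth : inner ℝ η (ε • ξ₀) = 0 := by rw [real_inner_smul_right, inner_rot_self, mul_zero]
  have hεn : 0 < ‖ε • ξ₀‖ := by rw [norm_smul, Real.norm_of_nonneg hε.le]; positivity
  have h1 : ‖η‖ < ‖η + ε • ξ₀‖ := by
    have := norm_add_sq_real η (ε • ξ₀)
    rw [horth] at this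
    exact lt_of_pow_lt_pow_left₀ 2 (norm_nonneg _) (by nlinarith)
  have h2 : ‖η‖ < ‖η - ε • ξ₀‖ := by
    have := norm_sub_sq_real η (ε • ξ₀)
    rw [horth] at this
    exact lt_of_pow_lt_pow_left₀ 2 (norm_nonneg _) (by nlinarith)
  nlinarith

end Strictness

section Circumcenter

open Module in
lemma convexHull_eq_image_stdSimplex {V : Type*} [AddCommGroup V] [Module ℝ V]
    [FiniteDimensional ℝ V] {s : Set V} (hs : s.Nonempty) :
    convexHull ℝ s = (fun p : (Fin (finrank ℝ V + 1) → ℝ) × (Fin (finrank ℝ V + 1) → V) =>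
      ∑ i, p.1 i • p.2 i) '' (stdSimplex ℝ (Fin (finrank ℝ V + 1)) ×ˢ Set.univ.pi fun _ => s) := by
  apply Set.Subset.antisymm
  · intro x hx
    obtain ⟨ι, _, z, w, hz, hind, hw, hw1, rfl⟩ := eq_pos_convex_span_of_mem_convexHull hx
    have hcard : Fintype.card ι ≤ Fintype.card (Fin (finrank ℝ V + 1)) := by
      rw [Fintype.card_fin]
      exact hind.card_le_finrank_succ.trans (Nat.succ_le_succ (Submodule.finrank_le _))
    obtain ⟨e⟩ := Function.Embedding.nonempty_of_card_le hcard
    obtain ⟨z₀, hz₀⟩ := hs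
    refine ⟨(Function.extend e w 0, Function.extend e z fun _ => z₀), ⟨⟨?_, ?_⟩, ?_⟩, ?_⟩
    · intro j
      by_cases hj : ∃ i, e i = j
      · obtain ⟨i, rfl⟩ := hj
        simpa only [e.injective.extend_apply] using (hw i).le
      · simp only [Function.extend_apply' _ _ _ hj, Pi.zero_apply, le_refl]
    · rw [← hw1]
      refine (Fintype.sum_of_injective e e.injective _ _ (fun j hj => ?_) fun i => ?_).symm
      · exact Function.extend_apply' _ _ _ hj
      · simp only [e.injective.extend_apply]
    · intro j _
      by_cases hj : ∃ i, e i = j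
      · obtain ⟨i, rfl⟩ := hj
        simpa only [e.injective.extend_apply] using hz ⟨i, rfl⟩
      · simpa only [Function.extend_apply' _ _ _ hj] using hz₀
    · refine (Fintype.sum_of_injective e e.injective _ _ (fun j hj => ?_) fun i => ?_).symm
      · simp only [Function.extend_apply' _ _ _ hj, Pi.zero_apply, zero_smul]
      · simp only [e.injective.extend_apply]
  · rintro _ ⟨⟨w, z⟩, ⟨⟨hw, hw1⟩, hz⟩, rfl⟩
    exact (convex_convexHull ℝ s).sum_mem (fun i _ => hw i) hw1
      fun i _ => subset_convexHull ℝ s (hz i (Set.mem_univ i))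

lemma isCompact_convexHull_of_isCompact {V : Type*} [NormedAddCommGroup V] [NormedSpace ℝ V]
    [FiniteDimensional ℝ V] {s : Set V} (hs : IsCompact s) : IsCompact (convexHull ℝ s) := by
  rcases s.eq_empty_or_nonempty with rfl | hne
  · simp
  · rw [convexHull_eq_image_stdSimplex hne]
    exact ((isCompact_stdSimplex ℝ _).prod (isCompact_univ_pi fun _ => hs)).image (by fun_prop)

lemma exists_circumcenter {T : Set (EuclideanSpace ℝ (Fin 2))} (hTc : IsCompact T)
    (hTne : T.Nonempty) :
    ∃ (c : EuclideanSpace ℝ (Fin 2)) (n : ℕ) (w : Fin n → ℝ)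
      (x : Fin n → EuclideanSpace ℝ (Fin 2)),
      T ⊆ Metric.closedBall c (circumradius T) ∧ (∀ i, 0 ≤ w i) ∧ ∑ i, w i = 1 ∧
      (∀ i, x i ∈ T) ∧ ∑ i, w i • x i = c ∧
      circumradius T ≤ ∑ i, w i * ‖x i - c‖ := by
  let lift : EuclideanSpace ℝ (Fin 2) → EuclideanSpace ℝ (Fin 2) × ℝ := fun x => (x, ‖x‖ ^ 2)
  have hK : IsCompact (convexHull ℝ (lift '' T)) :=
    isCompact_convexHull_of_isCompact (hTc.image (by fun_prop))
  have hmem : ∀ y ∈ T, lift y ∈ convexHull ℝ (lift '' T) := fun y hy =>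
    subset_convexHull ℝ _ (Set.mem_image_of_mem _ hy)
  obtain ⟨y₀, hy₀⟩ := hTne
  obtain ⟨⟨c, s⟩, hp, hmax⟩ := hK.exists_isMaxOn ⟨_, hmem y₀ hy₀⟩
    (f := fun p => p.2 - ‖p.1‖ ^ 2) (by fun_prop)
  rw [isMaxOn_iff] at hmax
  have hV0 : 0 ≤ s - ‖c‖ ^ 2 := by simpa [lift] using hmax _ (hmem y₀ hy₀)
  have hball : ∀ y ∈ T, ‖y - c‖ ^ 2 ≤ s - ‖c‖ ^ 2 := by
    intro y hy
    by_contra! hlt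
    set D := ‖y - c‖ ^ 2 with hD
    have hD0 : 0 < D := hV0.trans_lt hlt
    set t := (D - (s - ‖c‖ ^ 2)) / (2 * D) with ht
    have ht0 : 0 < t := div_pos (by linarith) (by positivity)
    have ht1 : t ≤ 1 := by rw [ht, div_le_one (by positivity)]; linarith
    have hq := hmax _ (convex_convexHull ℝ _ hp (hmem y hy) (sub_nonneg.2 ht1) ht0.le
      (sub_add_cancel 1 t))
    simp only [lift, Prod.smul_mk, Prod.mk_add_mk, smul_eq_mul] at hq
    have hexp : ‖(1 - t) • c + t • y‖ ^ 2 =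
        ‖c‖ ^ 2 + 2 * (t * inner ℝ c (y - c)) + t ^ 2 * D := by
      have : (1 - t) • c + t • y = c + t • (y - c) := by module
      rw [this, norm_add_sq_real, real_inner_smul_right, norm_smul, mul_pow,
        Real.norm_eq_abs, sq_abs]
    have hyc : ‖y‖ ^ 2 = ‖c‖ ^ 2 + 2 * inner ℝ c (y - c) + D := by
      rw [hD, ← norm_add_sq_real, add_sub_cancel]
    rw [hexp, hyc] at hq
    have h1 : t * (D - (s - ‖c‖ ^ 2)) ≤ t * (t * D) := by nlinarith
    have h2 := le_of_mul_le_mul_left h1 ht0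
    have h3 : t * D = (D - (s - ‖c‖ ^ 2)) / 2 := by rw [ht]; field_simp
    linarith
  rw [convexHull_eq_image_stdSimplex ⟨_, Set.mem_image_of_mem _ hy₀⟩] at hp
  obtain ⟨⟨w, z⟩, ⟨⟨hw, hw1⟩, hz⟩, hwz⟩ := hp
  choose x hxT hxz using fun i => hz i (Set.mem_univ i)
  have hz1 : ∀ i, (z i).1 = x i := fun i => congrArg Prod.fst (hxz i).symm
  have hz2 : ∀ i, (z i).2 = ‖x i‖ ^ 2 := fun i => congrArg Prod.snd (hxz i).symm
  have hc : ∑ i, w i • x i = c := by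
    simpa [Prod.fst_sum, hz1] using congrArg Prod.fst hwz
  have hs : ∑ i, w i * ‖x i‖ ^ 2 = s := by
    simpa [Prod.snd_sum, hz2] using congrArg Prod.snd hwz
  have hvar : ∀ c', ∑ i, w i * ‖x i - c'‖ ^ 2 = (s - ‖c‖ ^ 2) + ‖c - c'‖ ^ 2 := by
    intro c'
    have : ∀ i, w i * ‖x i - c'‖ ^ 2 =
        w i * ‖x i‖ ^ 2 - 2 * inner ℝ (w i • x i) c' + w i * ‖c'‖ ^ 2 := by
      intro i; rw [norm_sub_sq_real, real_inner_smul_left]; ring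
    simp_rw [this]
    rw [Finset.sum_add_distrib, Finset.sum_sub_distrib, hs, ← Finset.mul_sum, ← sum_inner,
      hc, ← Finset.sum_mul, hw1, norm_sub_sq_real]
    ring
  set R := √(s - ‖c‖ ^ 2) with hR
  have hRsq : R ^ 2 = s - ‖c‖ ^ 2 := Real.sq_sqrt hV0
  have hTR : T ⊆ Metric.closedBall c R := by
    intro y hy
    rw [mem_closedBall_iff_norm]
    exact Real.le_sqrt_of_sq_le (hball y hy)
  have hcirc : circumradius T = R := by
    refine IsLeast.csInf_eq ⟨⟨c, hTR⟩, ?_⟩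
    rintro r ⟨c', hr⟩
    have hr0 : 0 ≤ r := dist_nonneg.trans (hr hy₀)
    refine Real.sqrt_le_iff.2 ⟨hr0, ?_⟩
    calc s - ‖c‖ ^ 2 ≤ ∑ i, w i * ‖x i - c'‖ ^ 2 := by rw [hvar]; nlinarith
      _ ≤ ∑ i, w i * r ^ 2 := by
        gcongr with i
        · exact hw i
        · exact mem_closedBall_iff_norm.1 (hr (hxT i))
      _ = r ^ 2 := by rw [← Finset.sum_mul, hw1, one_mul]
  rw [hcirc]
  refine ⟨c, _, w, x, hTR, hw, hw1, hxT, hc, ?_⟩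
  rcases (Real.sqrt_nonneg (s - ‖c‖ ^ 2)).eq_or_lt with h0 | h0
  · rw [hR, ← h0]
    exact Finset.sum_nonneg fun i _ => mul_nonneg (hw i) (norm_nonneg _)
  · refine le_of_mul_le_mul_left ?_ h0
    have hv := hvar c
    rw [sub_self, norm_zero] at hv
    calc R * R = ∑ i, w i * ‖x i - c‖ ^ 2 := by rw [hv]; linarith
      _ ≤ ∑ i, R * (w i * ‖x i - c‖) := by
        refine Finset.sum_le_sum fun i _ => ?_
        have h1 : ‖x i - c‖ ≤ R := mem_closedBall_iff_norm.1 (hTR (hxT i))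
        calc w i * ‖x i - c‖ ^ 2 = ‖x i - c‖ * (w i * ‖x i - c‖) := by ring
          _ ≤ R * (w i * ‖x i - c‖) :=
            mul_le_mul_of_nonneg_right h1 (mul_nonneg (hw i) (norm_nonneg _))
      _ = R * ∑ i, w i * ‖x i - c‖ := by rw [Finset.mul_sum]

end Circumcenter

section Perimeter

variable {T : Set (EuclideanSpace ℝ (Fin 2))}

lemma width_eq_of_perim_le (hT : Convex ℝ T) (hTc : IsCompact T) (hTne : T.Nonempty)
    {ι : Type*} [Fintype ι] (w : ι → ℝ) (x : ι → EuclideanSpace ℝ (Fin 2))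
    (hle : ∀ ξ, ∑ i, w i * |inner ℝ (x i) ξ| ≤ width T ξ)
    (hp : perim T ≤ 2 * ∑ i, w i * ‖x i‖) (ξ : EuclideanSpace ℝ (Fin 2)) :
    width T ξ = ∑ i, w i * |inner ℝ (x i) ξ| := by
  by_contra hne
  have hpos : 0 < width T ξ - ∑ i, w i * |inner ℝ (x i) ξ| :=
    sub_pos.2 (lt_of_le_of_ne (hle ξ) (Ne.symm hne))
  have hcont : Continuous fun ξ => width T ξ - ∑ i, w i * |inner ℝ (x i) ξ| := by
    have := continuous_supportFun hTc
    unfold width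
    fun_prop
  have h := limit_cauchySum_pos hcont (fun c ξ => ?_) (fun ξ => sub_nonneg.2 (hle ξ)) hpos
    (tendsto_cauchySum_sub (tendsto_cauchySum_width hT hTc hTne)
      (tendsto_cauchySum_sum_abs_inner w x))
  · linarith
  · rw [width_smul hTc hTne, mul_sub, Finset.mul_sum]
    congr 1
    refine Finset.sum_congr rfl fun i _ => ?_
    rw [real_inner_smul_right, abs_mul]; ring

lemma le_perim_of_le_width (hT : Convex ℝ T) (hTc : IsCompact T) (hTne : T.Nonempty)
    {ι : Type*} [Fintype ι] (w : ι → ℝ) (x : ι → EuclideanSpace ℝ (Fin 2))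
    (hle : ∀ ξ, ∑ i, w i * |inner ℝ (x i) ξ| ≤ width T ξ) :
    2 * ∑ i, w i * ‖x i‖ ≤ perim T :=
  le_of_tendsto_of_tendsto' (tendsto_cauchySum_sum_abs_inner w x)
    (tendsto_cauchySum_width hT hTc hTne) fun n => cauchySum_mono n hle

lemma perim_segment (a b : EuclideanSpace ℝ (Fin 2)) :
    perim (segment ℝ a b) = 2 * ‖b - a‖ := by
  refine tendsto_nhds_unique (tendsto_cauchySum_width (convex_segment a b)
    (isCompact_segment a b) ⟨a, left_mem_segment ℝ a b⟩) ?_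
  rw [funext (width_segment a b)]
  exact tendsto_cauchySum_abs_inner _

lemma eq_of_supportFun_eq {S : Set (EuclideanSpace ℝ (Fin 2))} (hT : Convex ℝ T)
    (hTc : IsCompact T) (hTne : T.Nonempty) (hS : Convex ℝ S) (hSc : IsCompact S)
    (hSne : S.Nonempty) (h : ∀ ξ, supportFun T ξ = supportFun S ξ) : T = S := by
  apply Set.Subset.antisymm
  · intro x hx
    by_contra hxS
    obtain ⟨ξ, hξ⟩ := exists_supportFun_lt_inner hS hSc hSne hxS
    exact (hξ.trans_le (inner_le_supportFun hTc ξ hx)).ne (h ξ).symm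
  · intro x hx
    by_contra hxT
    obtain ⟨ξ, hξ⟩ := exists_supportFun_lt_inner hT hTc hTne hxT
    exact (hξ.trans_le (inner_le_supportFun hSc ξ hx)).ne (h ξ)

/-- If a probability measure on `[-m, M]` has mean zero, its mean absolute deviation is at most
`2 M m / (M + m)`. -/
lemma add_mul_sum_abs_le {ι : Type*} [Fintype ι] {w a : ι → ℝ} {M m : ℝ}
    (hw : ∀ i, 0 ≤ w i) (hw1 : ∑ i, w i = 1) (ha0 : ∑ i, w i * a i = 0)
    (hM : ∀ i, a i ≤ M) (hm : ∀ i, -a i ≤ m) (hM0 : 0 ≤ M) (hm0 : 0 ≤ m) :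
    (M + m) * ∑ i, w i * |a i| ≤ 2 * M * m := by
  calc (M + m) * ∑ i, w i * |a i| = ∑ i, w i * ((M + m) * |a i|) := by
        rw [Finset.mul_sum]; exact Finset.sum_congr rfl fun i _ => by ring
    _ ≤ ∑ i, (2 * M * m * w i + (M - m) * (w i * a i)) := by
        refine Finset.sum_le_sum fun i _ => ?_
        have : (M + m) * |a i| ≤ 2 * M * m + (M - m) * a i := by
          rcases abs_cases (a i) with h | h
          · rw [h.1]; nlinarith [hM i]
          · rw [h.1]; nlinarith [hm i]
        nlinarith [hw i]
    _ = 2 * M * m := by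
        rw [Finset.sum_add_distrib, ← Finset.mul_sum, ← Finset.mul_sum, hw1, ha0]; ring

lemma add_mul_sum_abs_inner_le (hTc : IsCompact T) {c : EuclideanSpace ℝ (Fin 2)}
    {ι : Type*} [Fintype ι] {w : ι → ℝ} {x : ι → EuclideanSpace ℝ (Fin 2)}
    (hw : ∀ i, 0 ≤ w i) (hw1 : ∑ i, w i = 1) (hx : ∀ i, x i ∈ T)
    (hc : ∑ i, w i • x i = c) (hcT : c ∈ T) (ξ : EuclideanSpace ℝ (Fin 2)) :
    width T ξ * ∑ i, w i * |inner ℝ (x i - c) ξ| ≤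
      2 * (supportFun T ξ - inner ℝ ξ c) * (supportFun T (-ξ) + inner ℝ ξ c) := by
  have hneg : ∀ y ∈ T, -inner ℝ ξ y ≤ supportFun T (-ξ) := fun y hy => by
    simpa only [inner_neg_left] using inner_le_supportFun hTc (-ξ) hy
  have h := add_mul_sum_abs_le (a := fun i => inner ℝ (x i - c) ξ)
    (M := supportFun T ξ - inner ℝ ξ c) (m := supportFun T (-ξ) + inner ℝ ξ c) hw hw1 ?_
    (fun i => ?_) (fun i => ?_) ?_ ?_
  · convert h using 2
    rw [width]; ring
  · simp_rw [← real_inner_smul_left]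
    rw [← sum_inner]
    simp_rw [smul_sub]
    rw [Finset.sum_sub_distrib, hc, ← Finset.sum_smul, hw1, one_smul, sub_self,
      inner_zero_left]
  · rw [real_inner_comm, inner_sub_right]
    linarith [inner_le_supportFun hTc ξ (hx i)]
  · rw [real_inner_comm, inner_sub_right]
    linarith [hneg _ (hx i)]
  · linarith [inner_le_supportFun hTc ξ hcT]
  · linarith [hneg c hcT]

end Perimeter

/-- `L(T) ≥ 4 R(T)`, with equality iff `T` is a line segment. -/
theorem perim_ge_four_circumradius
    {T : Set (EuclideanSpace ℝ (Fin 2))}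
    (hT : Convex ℝ T) (hTc : IsCompact T) (hTne : T.Nonempty) :
    perim T ≥ 4 * circumradius T ∧
      (perim T = 4 * circumradius T ↔
        ∃ a b : EuclideanSpace ℝ (Fin 2), T = segment ℝ a b) := by
  obtain ⟨c, n, w, x, hball, hw, hw1, hx, hc, hR⟩ := exists_circumcenter hTc hTne
  have hcT : c ∈ T := hc ▸ hT.sum_mem (fun i _ => hw i) hw1 fun i _ => hx i
  have hkey := add_mul_sum_abs_inner_le hTc hw hw1 hx hc hcT
  have hsupp : ∀ ξ, ∀ y ∈ T, |inner ℝ ξ (y - c)| ≤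
      max (supportFun T ξ - inner ℝ ξ c) (supportFun T (-ξ) + inner ℝ ξ c) := by
    intro ξ y hy
    have h1 := inner_le_supportFun hTc ξ hy
    have h2 := inner_le_supportFun hTc (-ξ) hy
    rw [inner_neg_left] at h2
    rw [inner_sub_right]
    rcases abs_cases (inner ℝ ξ y - inner ℝ ξ c) with h | h
    · exact le_max_of_le_left (by linarith)
    · exact le_max_of_le_right (by linarith)
  have hMm : ∀ ξ, 0 ≤ supportFun T ξ - inner ℝ ξ c ∧
      0 ≤ supportFun T (-ξ) + inner ℝ ξ c := by
    intro ξ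
    have h1 := inner_le_supportFun hTc ξ hcT
    have h2 := inner_le_supportFun hTc (-ξ) hcT
    rw [inner_neg_left] at h2
    constructor <;> linarith
  have hle : ∀ ξ, ∑ i, 2 * w i * |inner ℝ (x i - c) ξ| ≤ width T ξ := by
    intro ξ
    simp_rw [mul_assoc, ← Finset.mul_sum]
    have h := hkey ξ
    obtain ⟨hM, hm⟩ := hMm ξ
    have hwidth : width T ξ = (supportFun T ξ - inner ℝ ξ c) +
        (supportFun T (-ξ) + inner ℝ ξ c) := by rw [width]; ring
    rw [hwidth] at h ⊢
    set M := supportFun T ξ - inner ℝ ξ c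
    set m := supportFun T (-ξ) + inner ℝ ξ c
    rcases (add_nonneg hM hm).eq_or_lt with h0 | h0
    · have hz : ∀ i, |inner ℝ (x i - c) ξ| = 0 := fun i => by
        have := hsupp ξ (x i) (hx i)
        rw [real_inner_comm]
        exact le_antisymm (this.trans (max_le (by linarith) (by linarith))) (abs_nonneg _)
      simp [hz, ← h0]
    · refine le_of_mul_le_mul_left ?_ h0
      nlinarith [sq_nonneg (M - m)]
  have hsum : ∑ i, 2 * w i * ‖x i - c‖ = 2 * ∑ i, w i * ‖x i - c‖ := by
    simp_rw [mul_assoc, ← Finset.mul_sum]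
  have hge : perim T ≥ 4 * circumradius T := by
    have := le_perim_of_le_width hT hTc hTne _ _ hle
    rw [hsum] at this
    linarith
  refine ⟨hge, fun heq => ?_, ?_⟩
  · have hwid := width_eq_of_perim_le hT hTc hTne _ _ hle (by rw [hsum]; linarith)
    have hsymm : ∀ ξ, supportFun T ξ - inner ℝ ξ c = supportFun T (-ξ) + inner ℝ ξ c := by
      intro ξ
      have h := hkey ξ
      have h' := hwid ξ
      simp_rw [mul_assoc, ← Finset.mul_sum] at h'
      have hwidth : width T ξ = (supportFun T ξ - inner ℝ ξ c) +
          (supportFun T (-ξ) + inner ℝ ξ c) := by rw [width]; ring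
      rw [hwidth] at h h'
      have : ((supportFun T ξ - inner ℝ ξ c) - (supportFun T (-ξ) + inner ℝ ξ c)) ^ 2 ≤ 0 := by
        linear_combination 2 * h + ((supportFun T ξ - inner ℝ ξ c) +
          (supportFun T (-ξ) + inner ℝ ξ c)) * h'
      exact sub_eq_zero.1 (pow_eq_zero_iff two_ne_zero |>.1 (le_antisymm this (sq_nonneg _)))
    obtain ⟨i, hi⟩ : ∃ i, circumradius T ≤ ‖x i - c‖ := by
      by_contra! hlt
      obtain ⟨i, -, hi⟩ : ∃ i ∈ Finset.univ, w i ≠ 0 :=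
        Finset.exists_ne_zero_of_sum_ne_zero (by rw [hw1]; exact one_ne_zero)
      refine hR.not_gt ?_
      calc ∑ i, w i * ‖x i - c‖ < ∑ i, w i * circumradius T :=
            Finset.sum_lt_sum (fun j _ => mul_le_mul_of_nonneg_left (hlt j).le (hw j))
              ⟨i, Finset.mem_univ i,
                mul_lt_mul_of_pos_left (hlt i) ((hw i).lt_of_ne' hi)⟩
        _ = circumradius T := by rw [← Finset.sum_mul, hw1, one_mul]
    set d := x i - c with hd
    have hsuppd : ∀ ξ, |inner ℝ ξ d| ≤ supportFun T ξ - inner ℝ ξ c := by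
      intro ξ
      have := hsupp ξ _ (hx i)
      rwa [← hsymm ξ, max_self] at this
    have hwidth : ∀ ξ, width T ξ = 2 * (supportFun T ξ - inner ℝ ξ c) := by
      intro ξ; rw [width]; linarith [hsymm ξ]
    have hwid' := width_eq_of_perim_le hT hTc hTne (fun _ : Unit => 2) (fun _ => d)
      (fun ξ => by
        rw [Finset.univ_unique, Finset.sum_singleton, hwidth, real_inner_comm]
        linarith [hsuppd ξ])
      (by rw [Finset.univ_unique, Finset.sum_singleton]; linarith)
    refine ⟨c - d, c + d, eq_of_supportFun_eq hT hTc hTne (convex_segment _ _)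
      (isCompact_segment _ _) ⟨_, left_mem_segment ℝ _ _⟩ fun ξ => ?_⟩
    have h := hwid' ξ
    rw [Finset.univ_unique, Finset.sum_singleton, hwidth, real_inner_comm ξ d] at h
    rw [supportFun_segment, inner_sub_right, inner_add_right, sub_eq_add_neg,
      max_add_add_left, max_comm, ← abs_eq_max_neg]
    linarith
  · rintro ⟨a, b, hab⟩
    refine le_antisymm ?_ hge
    have ha := hball (hab ▸ left_mem_segment ℝ a b)
    have hb := hball (hab ▸ right_mem_segment ℝ a b)
    have hp : perim T = 2 * ‖b - a‖ := by rw [hab, perim_segment]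
    rw [hp, ← dist_eq_norm]
    have := dist_triangle_right b a c
    rw [Metric.mem_closedBall] at ha hb
    linarith
end
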